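/- Let Ω ⊂ ℂ be a bounded set. There exists h₀ > 0 such that for every C > 0 there exists A > 0 with the following property: for all h ∈ (0, h₀], all z ∈ Ω with dist(z, Λ_h) ≥ 1/C, and all Schwartz functions u on ℝⁿ, one has ‖u‖_{L²(ℝⁿ)} ≤ A e^{A/h} ‖(q^w(x,hD_x) − z)u‖_{L²(ℝⁿ)}. (Since Λ_h is exactly the spectrum of q^w(x,hD_x), this is an a priori form of the resolvent bound ‖(q^w(x,hD_x) − z)^{-1}‖ ≤ A e^{A/h}.) -/

import Mathlib

open MeasureTheory

/-- The quadratic form `q(x,ξ) = ⟨Ax,x⟩ + 2⟨Bx,ξ⟩ + ⟨Cξ,ξ⟩` on ℂⁿ×ℂⁿ. -/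
noncomputable def qForm {n : ℕ} (A B C : Matrix (Fin n) (Fin n) ℂ)
    (x ξ : Fin n → ℂ) : ℂ :=
  (∑ j, ∑ k, A j k * x k * x j) + 2 * ∑ k, (∑ l, B k l * x l) * ξ k
    + ∑ j, ∑ k, C j k * ξ k * ξ j

/-- The symmetric bilinear polarization `q(X,Y)` of `q`, on `ℂ^{2n} = ℂⁿ ⊕ ℂⁿ`. -/
noncomputable def qPolar {n : ℕ} (A B C : Matrix (Fin n) (Fin n) ℂ)
    (X Y : (Fin n ⊕ Fin n) → ℂ) : ℂ :=
  (∑ j, ∑ k, A j k * X (Sum.inl k) * Y (Sum.inl j))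
    + (∑ k, (∑ l, B k l * X (Sum.inl l)) * Y (Sum.inr k))
    + (∑ k, (∑ l, B k l * Y (Sum.inl l)) * X (Sum.inr k))
    + ∑ j, ∑ k, C j k * X (Sum.inr k) * Y (Sum.inr j)

/-- The complex symplectic form `σ((x,ξ),(y,η)) = ⟨ξ,y⟩ − ⟨x,η⟩` on `ℂ^{2n}`. -/
noncomputable def sympForm {n : ℕ} (X Y : (Fin n ⊕ Fin n) → ℂ) : ℂ :=
  (∑ j, X (Sum.inr j) * Y (Sum.inl j)) - ∑ j, X (Sum.inl j) * Y (Sum.inr j)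

/-- The semiclassical Weyl quantization
`q^w(x,hD_x)u = ⟨Ax,x⟩u − h² Σ_{j,k} C_{jk} ∂²u/∂x_j∂x_k
 + (2h/i) Σ_k (Bx)_k ∂u/∂x_k + (h/i)(tr B)u`. -/
noncomputable def weylQuant {n : ℕ} (A B C : Matrix (Fin n) (Fin n) ℂ) (h : ℝ)
    (u : EuclideanSpace ℝ (Fin n) → ℂ) (x : EuclideanSpace ℝ (Fin n)) : ℂ :=
  (∑ j, ∑ k, A j k * (x j : ℂ) * (x k : ℂ)) * u x
    - (h : ℂ) ^ 2 * ∑ j, ∑ k, C j k *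
        fderiv ℝ (fun y => fderiv ℝ u y (EuclideanSpace.single k 1)) x
          (EuclideanSpace.single j 1)
    + (2 * (h : ℂ) / Complex.I) * ∑ k, (∑ l, B k l * (x l : ℂ)) *
        fderiv ℝ u x (EuclideanSpace.single k 1)
    + ((h : ℂ) / Complex.I) * (∑ j, B j j) * u x

/-- The `L²(ℝⁿ)`-norm of a function. -/
noncomputable def l2Norm {n : ℕ} (f : EuclideanSpace ℝ (Fin n) → ℂ) : ℝ :=
  Real.sqrt (∫ x : EuclideanSpace ℝ (Fin n), ‖f x‖ ^ 2)

/-- The set `Λ_h = {(h/i) Σ_j λ_j(2ν_j+1) : ν ∈ ℕⁿ}`, which is the spectrum of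
`q^w(x,hD_x)`. -/
noncomputable def specSet {n : ℕ} (lam : Fin n → ℂ) (h : ℝ) : Set ℂ :=
  {w | ∃ ν : Fin n → ℕ, w = (h : ℂ) / Complex.I * ∑ j, lam j * (2 * (ν j : ℂ) + 1)}


namespace QRes

open Module.Basis in
theorem charpoly_eq_mul_mapQ {V : Type*} [AddCommGroup V] [Module ℂ V] [FiniteDimensional ℂ V]
    (W : Submodule ℂ V) (e : V →ₗ[ℂ] V) (he : W ≤ W.comap e) :
    e.charpoly = (e.restrict he).charpoly * (W.mapQ W e he).charpoly := by
  let m := Module.Free.ChooseBasisIndex ℂ W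
  let bW : Module.Basis m ℂ W := Module.Free.chooseBasis ℂ W
  let n := Module.Free.ChooseBasisIndex ℂ (V ⧸ W)
  let bQ : Module.Basis n ℂ (V ⧸ W) := Module.Free.chooseBasis ℂ (V ⧸ W)
  let b := sumQuot bW bQ
  let A : Matrix m m ℂ := LinearMap.toMatrix bW bW (e.restrict he)
  let B : Matrix m n ℂ := Matrix.of fun i l ↦
    ((sumQuot bW bQ).repr (e ((sumQuot bW bQ) (Sum.inr l)))) (Sum.inl i)
  let D : Matrix n n ℂ := LinearMap.toMatrix bQ bQ (W.mapQ W e he)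
  suffices LinearMap.toMatrix b b e = Matrix.fromBlocks A B 0 D by
    rw [← LinearMap.charpoly_toMatrix e b, this, ← LinearMap.charpoly_toMatrix _ bW,
      ← LinearMap.charpoly_toMatrix _ bQ, Matrix.charpoly_fromBlocks_zero₂₁]
  ext u v
  cases u with
  | inl i =>
    cases v with
    | inl k =>
      simp only [b, sumQuot_inl, Matrix.fromBlocks_apply₁₁, A, LinearMap.toMatrix_apply]
      apply sumQuot_repr_inl_of_mem
    | inr l => simp [b, LinearMap.toMatrix_apply, Matrix.fromBlocks_apply₁₂, B]
  | inr j =>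
    cases v with
    | inl k =>
      suffices W.mkQ (e (bW k)) = 0 by simp [LinearMap.toMatrix_apply, b, this]
      rw [← LinearMap.mem_ker, Submodule.ker_mkQ]
      exact he (Submodule.coe_mem (bW k))
    | inr l =>
      simp only [LinearMap.toMatrix_apply, sumQuot_repr_inr,
        Matrix.fromBlocks_apply₂₂, b, D]
      rw [← sumQuot_inr bW bQ l, W.mapQ_apply]
      simp

theorem exists_flag (m : ℕ) : ∀ (V : Type) [AddCommGroup V] [Module ℂ V] [FiniteDimensional ℂ V]
    (f : V →ₗ[ℂ] V) (μ : Fin m → ℂ),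
    (∏ j, (Polynomial.X - Polynomial.C (μ j))) ∣ f.charpoly →
    ∃ Y : Fin m → V, LinearIndependent ℂ Y ∧
      ∀ j, f (Y j) - μ j • Y j ∈ Submodule.span ℂ (Y '' {i | i < j}) := by
  induction m with
  | zero =>
    intro V _ _ _ f μ _
    exact ⟨fun j => j.elim0, linearIndependent_empty_type, fun j => j.elim0⟩
  | succ m ih =>
    intro V _ _ _ f μ hdvd
    rw [Fin.prod_univ_succ] at hdvd
    have hroot : f.charpoly.IsRoot (μ 0) := by
      rw [← Polynomial.dvd_iff_isRoot]
      exact (dvd_mul_right _ _).trans hdvd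
    obtain ⟨v, hv⟩ := (Module.End.hasEigenvalue_iff_isRoot_charpoly f (μ 0) |>.2 hroot).exists_hasEigenvector
    have hv1 : f v = μ 0 • v := hv.apply_eq_smul
    have hv0 : v ≠ 0 := hv.2
    set W := Submodule.span ℂ {v} with hW
    have he : W ≤ W.comap f := by
      rw [hW, Submodule.span_singleton_le_iff_mem, Submodule.mem_comap, hv1]
      exact Submodule.smul_mem _ _ (Submodule.mem_span_singleton_self v)
    have hc := charpoly_eq_mul_mapQ W f he
    have hr : (f.restrict (p := W) (q := W) he) = μ 0 • LinearMap.id := by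
      ext ⟨x, hx⟩
      obtain ⟨a, rfl⟩ := Submodule.mem_span_singleton.1 hx
      simp only [LinearMap.restrict_apply, LinearMap.smul_apply, LinearMap.id_apply, map_smul, hv1,
        Submodule.coe_smul]
      rw [smul_comm]
    have hfr : Module.finrank ℂ W = 1 := finrank_span_singleton hv0
    have hrc : (f.restrict (p := W) (q := W) he).charpoly = Polynomial.X - Polynomial.C (μ 0) := by
      let b : Module.Basis (Fin 1) ℂ W := Module.finBasisOfFinrankEq ℂ W hfr
      rw [hr, ← LinearMap.charpoly_toMatrix _ b]
      simp [Matrix.charpoly]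
    rw [hc, hrc] at hdvd
    have hdvd' := (mul_dvd_mul_iff_left (Polynomial.X_sub_C_ne_zero (μ 0))).1 hdvd
    obtain ⟨Y, hY, hYf⟩ := ih (V ⧸ W) (W.mapQ W f he) (fun j => μ j.succ) hdvd'
    choose Z hZ using fun j => W.mkQ_surjective (Y j)
    refine ⟨Fin.cons v Z, ?_, ?_⟩
    · rw [linearIndependent_finCons]
      have hZY : W.mkQ ∘ Z = Y := funext hZ
      refine ⟨LinearIndependent.of_comp W.mkQ (hZY ▸ hY), ?_⟩
      intro hmem
      rw [Submodule.mem_span_range_iff_exists_fun] at hmem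
      obtain ⟨c, hc⟩ := hmem
      have h1 : ∑ i, c i • Y i = 0 := by
        have : W.mkQ (∑ i, c i • Z i) = 0 := by
          rw [hc]; simp [hW]
        simpa [map_sum, hZ] using this
      have h2 := Fintype.linearIndependent_iff.1 hY c h1
      apply hv0
      rw [← hc]
      simp [h2]
    · intro j
      refine Fin.cases ?_ (fun j => ?_) j
      · simp [hv1]
      · have h1 := hYf j
        simp only [Fin.cons_succ]
        have h2 : W.mkQ (f (Z j) - μ j.succ • Z j) ∈ Submodule.map W.mkQ (Submodule.span ℂ (Z '' {i | i < j})) := by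
          rw [Submodule.map_span, ← Set.image_comp]
          have hZY : W.mkQ ∘ Z = Y := funext hZ
          rw [hZY]
          rw [← hZ j] at h1
          simpa using h1
        obtain ⟨s, hs, hs2⟩ := h2
        have h3 : (f (Z j) - μ j.succ • Z j) - s ∈ W := by
          rw [← Submodule.ker_mkQ W, LinearMap.mem_ker, map_sub, hs2, sub_self]
        have h4 : f (Z j) - μ j.succ • Z j = ((f (Z j) - μ j.succ • Z j) - s) + s := by abel
        rw [h4]
        refine Submodule.add_mem _ ?_ ?_
        · refine (Submodule.span_mono ?_) h3
          rintro _ rfl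
          exact ⟨0, Fin.succ_pos j, rfl⟩
        · refine (Submodule.span_mono ?_) hs
          rintro _ ⟨i, hi, rfl⟩
          exact ⟨i.succ, Fin.succ_lt_succ_iff.2 hi, rfl⟩

end QRes


namespace QRes

/-- If `x` lies in the span of an orthonormal family, then it is recovered from its coefficients. -/
theorem span_expand {V : Type} [AddCommGroup V] [Module ℂ V] {m : ℕ} (H : V → V →ₗ[ℂ] ℂ)
    (Z : Fin m → V) (hZ : ∀ i j, H (Z i) (Z j) = if i = j then 1 else 0) (x : V)
    (hx : x ∈ Submodule.span ℂ (Set.range Z)) : x = ∑ l, H (Z l) x • Z l := by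
  rw [Submodule.mem_span_range_iff_exists_fun] at hx
  obtain ⟨c, rfl⟩ := hx
  refine Finset.sum_congr rfl fun l _ => ?_
  simp [map_sum, hZ]

theorem exists_ortho_flag {V : Type} [AddCommGroup V] [Module ℂ V] (H : V → V →ₗ[ℂ] ℂ)
    (hsymm : ∀ x y, H y x = star (H x y)) (f : V →ₗ[ℂ] V)
    (hpos : ∀ z, z ≠ 0 → 0 < (Complex.I * H z (f z)).re) (m : ℕ) :
    ∀ (Y : Fin m → V) (lam : Fin m → ℂ), (∀ j, 0 < (lam j).im) → LinearIndependent ℂ Y →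
      (∀ j, f (Y j) + lam j • Y j ∈ Submodule.span ℂ (Y '' {i | i < j})) →
      ∃ Z : Fin m → V, (∀ i j, H (Z i) (Z j) = if i = j then 1 else 0) ∧
        Submodule.span ℂ (Set.range Z) = Submodule.span ℂ (Set.range Y) ∧
        ∀ j, f (Z j) + lam j • Z j ∈ Submodule.span ℂ (Z '' {i | i < j}) := by
  induction m with
  | zero =>
    intro Y lam _ _ _
    exact ⟨Y, fun i => i.elim0, rfl, fun j => j.elim0⟩
  | succ m ih =>
    intro Y lam hlam hY hflag
    have himg : ∀ (X : Fin (m+1) → V) (j : Fin m), X '' {i | i < j.castSucc} =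
        (fun i : Fin m => X i.castSucc) '' {i | i < j} := by
      intro X j
      ext x
      constructor
      · rintro ⟨i, hi, rfl⟩
        have hi' : i < j.castSucc := hi
        refine ⟨⟨i, lt_trans hi' j.2⟩, ?_, rfl⟩
        exact hi'
      · rintro ⟨i, hi, rfl⟩
        exact ⟨i.castSucc, by simpa using hi, rfl⟩
    have himgl : ∀ (X : Fin (m+1) → V), X '' {i | i < Fin.last m} =
        Set.range (fun i : Fin m => X i.castSucc) := by
      intro X
      ext x
      constructor
      · rintro ⟨i, hi, rfl⟩
        have hi' : i < Fin.last m := hi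
        exact ⟨⟨i, hi'⟩, rfl⟩
      · rintro ⟨i, rfl⟩
        exact ⟨i.castSucc, Fin.castSucc_lt_last i, rfl⟩
    obtain ⟨Z, hZo, hZs, hZf⟩ := ih (fun i => Y i.castSucc) (fun i => lam i.castSucc)
      (fun i => hlam _) (hY.comp _ (Fin.castSucc_injective m)) (by
        intro j
        have := hflag j.castSucc
        rwa [himg] at this)
    -- invariance of the span
    have hZinv : ∀ w ∈ Submodule.span ℂ (Set.range Z), f w ∈ Submodule.span ℂ (Set.range Z) := by
      intro w hw
      induction hw using Submodule.span_induction with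
      | mem x hx =>
        obtain ⟨i, rfl⟩ := hx
        have h1 := Submodule.span_mono (Set.image_subset_range Z {k | k < i}) (hZf i)
        have h2 : lam i.castSucc • Z i ∈ Submodule.span ℂ (Set.range Z) :=
          Submodule.smul_mem _ _ (Submodule.subset_span ⟨i, rfl⟩)
        simpa using Submodule.sub_mem _ h1 h2
      | zero => simp
      | add x y _ _ hx hy => rw [map_add]; exact Submodule.add_mem _ hx hy
      | smul a x _ hx => rw [map_smul]; exact Submodule.smul_mem _ _ hx
    set y := Y (Fin.last m) with hy
    set p := ∑ l, H (Z l) y • Z l with hp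
    have hpm : p ∈ Submodule.span ℂ (Set.range Z) :=
      Submodule.sum_mem _ fun l _ => Submodule.smul_mem _ _ (Submodule.subset_span ⟨l, rfl⟩)
    set z := y - p with hz
    have hynot : y ∉ Submodule.span ℂ (Set.range Z) := by
      rw [hZs]
      have := hY.notMem_span_image (s := {i | i < Fin.last m}) (x := Fin.last m) (by simp)
      rwa [himgl] at this
    have hz0 : z ≠ 0 := by
      intro h0
      apply hynot
      have : y = p := by rw [← sub_eq_zero]; exact h0
      rw [this]; exact hpm
    have horth : ∀ l, H (Z l) z = 0 := by
      intro l
      simp [hz, hp, map_sum, hZo]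
    have horth' : ∀ w ∈ Submodule.span ℂ (Set.range Z), H z w = 0 := by
      intro w hw
      rw [span_expand H Z hZo w hw, map_sum]
      refine Finset.sum_eq_zero fun l _ => ?_
      rw [map_smul, hsymm (Z l) z, horth, star_zero, smul_zero]
    have hfz : f z + lam (Fin.last m) • z ∈ Submodule.span ℂ (Set.range Z) := by
      have h1 := hflag (Fin.last m)
      rw [himgl, ← hZs] at h1
      have h2 := hZinv p hpm
      have h3 := Submodule.smul_mem _ (lam (Fin.last m)) hpm
      have : f z + lam (Fin.last m) • z = (f y + lam (Fin.last m) • y) - f p - lam (Fin.last m) • p := by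
        rw [hz, map_sub, smul_sub]; abel
      rw [this]
      exact Submodule.sub_mem _ (Submodule.sub_mem _ h1 h2) h3
    have hHz : H z (f z) = - lam (Fin.last m) * H z z := by
      have := horth' _ hfz
      rw [map_add, map_smul, smul_eq_mul] at this
      linear_combination this
    have hreal : (H z z).im = 0 := by
      have := congrArg Complex.im (hsymm z z)
      simp at this
      linarith
    have hHpos : 0 < (H z z).re := by
      have h1 := hpos z hz0
      rw [hHz] at h1
      simp [hreal] at h1
      have := hlam (Fin.last m)
      by_contra hneg
      push Not at hneg
      nlinarith
    set r := (H z z).re with hr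
    have hHr : H z z = (r : ℂ) := by apply Complex.ext <;> simp [hr, hreal]
    set c : ℂ := Complex.ofReal (Real.sqrt r)⁻¹ with hc
    have hc0 : c ≠ 0 := by
      rw [hc]; simp [Real.sqrt_ne_zero'.2 hHpos]
    have hcc : c * c * H z z = 1 := by
      rw [hHr, hc, ← Complex.ofReal_mul, ← Complex.ofReal_mul, ← mul_inv, Real.mul_self_sqrt hHpos.le,
        inv_mul_cancel₀ hHpos.ne', Complex.ofReal_one]
    have hcstar : star c = c := by simp [hc]
    have hHc : ∀ x, H (c • z) x = c * H z x := by
      intro x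
      rw [hsymm x (c • z), map_smul, smul_eq_mul, star_mul', hcstar, ← hsymm]
    refine ⟨Fin.snoc Z (c • z), ?_, ?_, ?_⟩
    · intro i j
      refine Fin.lastCases ?_ (fun i => ?_) i <;> refine Fin.lastCases ?_ (fun j => ?_) j
      · simp [hHc, ← mul_assoc, hcc]
      · have : H z (Z j) = 0 := horth' _ (Submodule.subset_span ⟨j, rfl⟩)
        simp [hHc, this, Fin.ext_iff]
        intro h; have := j.2; omega
      · simp [horth, Fin.ext_iff]
        intro h; have := i.2; omega
      · simp [hZo]
    · have hr1 : ∀ (X : Fin (m+1) → V), Set.range X = insert (X (Fin.last m)) (Set.range (fun i : Fin m => X i.castSucc)) := by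
        intro X
        ext x
        constructor
        · rintro ⟨i, rfl⟩
          refine Fin.lastCases (Or.inl rfl) (fun i => Or.inr ⟨i, rfl⟩) i
        · rintro (rfl | ⟨i, rfl⟩)
          · exact ⟨_, rfl⟩
          · exact ⟨_, rfl⟩
      rw [hr1, hr1 Y]
      simp only [Fin.snoc_last, Fin.snoc_castSucc]
      rw [Submodule.span_insert, Submodule.span_insert, ← hZs]
      apply le_antisymm
      · refine sup_le ?_ le_sup_right
        rw [Submodule.span_singleton_le_iff_mem]
        refine Submodule.smul_mem _ _ (Submodule.sub_mem _ ?_ ?_)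
        · exact Submodule.mem_sup_left (Submodule.mem_span_singleton_self _)
        · exact Submodule.mem_sup_right hpm
      · refine sup_le ?_ le_sup_right
        rw [Submodule.span_singleton_le_iff_mem]
        have : y = c⁻¹ • (c • z) + p := by
          rw [smul_smul, inv_mul_cancel₀ hc0, one_smul, hz]; abel
        change y ∈ _
        rw [this]
        refine Submodule.add_mem _ ?_ (Submodule.mem_sup_right hpm)
        exact Submodule.smul_mem _ _ (Submodule.mem_sup_left (Submodule.mem_span_singleton_self _))
    · intro j
      refine Fin.lastCases ?_ (fun j => ?_) j
      · rw [himgl]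
        simp only [Fin.snoc_last, Fin.snoc_castSucc]
        have := Submodule.smul_mem _ c hfz
        rw [map_smul, smul_comm, ← smul_add]
        exact this
      · rw [himg]
        simp only [Fin.snoc_castSucc]
        exact hZf j

end QRes


namespace QRes

variable {n : ℕ}

theorem sympForm_swap (X Y : (Fin n ⊕ Fin n) → ℂ) : sympForm X Y = - sympForm Y X := by
  simp only [sympForm, neg_sub]
  congr 1 <;> exact Finset.sum_congr rfl fun j _ => mul_comm _ _

theorem sympForm_add_right (X Y Z : (Fin n ⊕ Fin n) → ℂ) :
    sympForm X (Y + Z) = sympForm X Y + sympForm X Z := by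
  simp only [sympForm, Pi.add_apply, mul_add, Finset.sum_add_distrib]; ring

theorem sympForm_smul_right (a : ℂ) (X Y : (Fin n ⊕ Fin n) → ℂ) :
    sympForm X (a • Y) = a * sympForm X Y := by
  simp only [sympForm, Pi.smul_apply, smul_eq_mul, mul_sub, Finset.mul_sum]
  congr 1 <;> exact Finset.sum_congr rfl fun j _ => by ring

/-- The symplectic form, linear in the second variable. -/
noncomputable def sympLin (X : (Fin n ⊕ Fin n) → ℂ) : ((Fin n ⊕ Fin n) → ℂ) →ₗ[ℂ] ℂ where
  toFun Y := sympForm X Y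
  map_add' := sympForm_add_right X
  map_smul' a Y := sympForm_smul_right a X Y

theorem star_sympForm (X Y : (Fin n ⊕ Fin n) → ℂ) :
    star (sympForm X Y) = sympForm (star X) (star Y) := by
  simp [sympForm, star_sum, mul_comm]

theorem qPolar_symm (A B C : Matrix (Fin n) (Fin n) ℂ) (hAs : A.IsSymm) (hCs : C.IsSymm)
    (X Y : (Fin n ⊕ Fin n) → ℂ) : qPolar A B C X Y = qPolar A B C Y X := by
  have hA : ∀ (D : Matrix (Fin n) (Fin n) ℂ), D.IsSymm → ∀ x y : Fin n → ℂ,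
      ∑ j, ∑ k, D j k * x k * y j = ∑ j, ∑ k, D j k * y k * x j := by
    intro D hD x y
    rw [Finset.sum_comm]
    refine Finset.sum_congr rfl fun j _ => Finset.sum_congr rfl fun k _ => ?_
    rw [← hD.apply j k]; ring
  unfold qPolar
  rw [hA A hAs (fun k => X (Sum.inl k)) (fun k => Y (Sum.inl k)),
    hA C hCs (fun k => X (Sum.inr k)) (fun k => Y (Sum.inr k))]
  ring

/-- `q(conj Z, Z)` has real part `Re q(Re Z) + Re q(Im Z)`. -/
theorem qPolar_star_re (A B C : Matrix (Fin n) (Fin n) ℂ) (hAs : A.IsSymm) (hCs : C.IsSymm)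
    (Z : (Fin n ⊕ Fin n) → ℂ) : (qPolar A B C (star Z) Z).re =
      (qForm A B C (fun j => ((Z (Sum.inl j)).re : ℂ)) (fun j => ((Z (Sum.inr j)).re : ℂ))).re +
      (qForm A B C (fun j => ((Z (Sum.inl j)).im : ℂ)) (fun j => ((Z (Sum.inr j)).im : ℂ))).re := by
  have key : qPolar A B C (star Z) Z + qPolar A B C Z (star Z) = 2 *
    (qForm A B C (fun j => ((Z (Sum.inl j)).re : ℂ)) (fun j => ((Z (Sum.inr j)).re : ℂ)) +
      qForm A B C (fun j => ((Z (Sum.inl j)).im : ℂ)) (fun j => ((Z (Sum.inr j)).im : ℂ))) := by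
    have e1 : ∀ a b : ℂ, star a * b + a * star b = 2 * ((a.re : ℂ) * b.re + (a.im : ℂ) * b.im) := by
      intro a b
      apply Complex.ext <;> simp <;> ring
    have h1 : ∀ (D : Matrix (Fin n) (Fin n) ℂ) (x : Fin n → ℂ),
        (∑ j, ∑ k, D j k * star (x k) * x j) + (∑ j, ∑ k, D j k * x k * star (x j)) =
        2 * ((∑ j, ∑ k, D j k * ((x k).re : ℂ) * (x j).re) +
          (∑ j, ∑ k, D j k * ((x k).im : ℂ) * (x j).im)) := by
      intro D x
      simp only [← Finset.sum_add_distrib, Finset.mul_sum]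
      refine Finset.sum_congr rfl fun j _ => Finset.sum_congr rfl fun k _ => ?_
      linear_combination (D j k) * e1 (x k) (x j)
    have h2 : ∀ (x y : Fin n → ℂ),
        (∑ k, (∑ l, B k l * star (x l)) * y k) + (∑ k, (∑ l, B k l * x l) * star (y k)) =
        2 * ((∑ k, (∑ l, B k l * ((x l).re : ℂ)) * (y k).re) +
          (∑ k, (∑ l, B k l * ((x l).im : ℂ)) * (y k).im)) := by
      intro x y
      simp only [← Finset.sum_add_distrib, Finset.mul_sum, Finset.sum_mul]
      refine Finset.sum_congr rfl fun j _ => Finset.sum_congr rfl fun k _ => ?_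
      linear_combination (B j k) * e1 (x k) (y j)
    have hA := h1 A (fun k => Z (Sum.inl k))
    have hC := h1 C (fun k => Z (Sum.inr k))
    have hB := h2 (fun k => Z (Sum.inl k)) (fun k => Z (Sum.inr k))
    simp only [qPolar, qForm, Pi.star_apply]
    linear_combination hA + hC + 2 * hB
  rw [← qPolar_symm A B C hAs hCs (star Z) Z] at key
  have := congrArg Complex.re key
  simp at this
  linarith

theorem qPolar_star_pos (A B C : Matrix (Fin n) (Fin n) ℂ) (hAs : A.IsSymm) (hCs : C.IsSymm)
    (hpos : ∀ x ξ : Fin n → ℝ, ¬(x = 0 ∧ ξ = 0) →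
      0 < (qForm A B C (fun j => (x j : ℂ)) (fun j => (ξ j : ℂ))).re)
    (Z : (Fin n ⊕ Fin n) → ℂ) (hZ : Z ≠ 0) : 0 < (qPolar A B C (star Z) Z).re := by
  have h0 : ∀ x ξ : Fin n → ℝ, 0 ≤ (qForm A B C (fun j => (x j : ℂ)) (fun j => (ξ j : ℂ))).re := by
    intro x ξ
    by_cases h : x = 0 ∧ ξ = 0
    · simp [h.1, h.2, qForm]
    · exact (hpos x ξ h).le
  rw [qPolar_star_re A B C hAs hCs]
  by_cases h : (fun j => (Z (Sum.inl j)).re) = 0 ∧ (fun j => (Z (Sum.inr j)).re) = 0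
  · have h' : ¬ ((fun j => (Z (Sum.inl j)).im) = 0 ∧ (fun j => (Z (Sum.inr j)).im) = 0) := by
      intro h'
      apply hZ
      funext a
      rcases a with j | j
      · exact Complex.ext (congrFun h.1 j) (congrFun h'.1 j)
      · exact Complex.ext (congrFun h.2 j) (congrFun h'.2 j)
    exact add_pos_of_nonneg_of_pos (h0 _ _) (hpos _ _ h')
  · exact add_pos_of_pos_of_nonneg (hpos _ _ h) (h0 _ _)

theorem lin_main
    (A B C : Matrix (Fin n) (Fin n) ℂ) (hAs : A.IsSymm) (hCs : C.IsSymm)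
    (hpos : ∀ x ξ : Fin n → ℝ, ¬(x = 0 ∧ ξ = 0) →
      0 < (qForm A B C (fun j => (x j : ℂ)) (fun j => (ξ j : ℂ))).re)
    (F : Matrix (Fin n ⊕ Fin n) (Fin n ⊕ Fin n) ℂ)
    (hF : ∀ X Y, sympForm X (F.mulVec Y) = qPolar A B C X Y)
    (lam : Fin n → ℂ) (hlam : ∀ j, 0 < (lam j).im)
    (hchar : F.charpoly =
      ∏ j, ((Polynomial.X - Polynomial.C (lam j)) * (Polynomial.X + Polynomial.C (lam j)))) :
    ∃ (Y : Fin n → (Fin n ⊕ Fin n) → ℂ) (T : Matrix (Fin n) (Fin n) ℂ),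
      (∀ j k, k < j → T j k = 0) ∧ (∀ j, T j j = lam j) ∧
      (∀ k, F.mulVec (Y k) = - ∑ l, T l k • Y l) ∧
      (∀ j k, sympForm (Y j) (Y k) = 0) ∧
      (∀ j k, sympForm (star (Y j)) (Y k) = if j = k then Complex.I else 0) := by
  set f : ((Fin n ⊕ Fin n) → ℂ) →ₗ[ℂ] ((Fin n ⊕ Fin n) → ℂ) := Matrix.toLin' F with hf
  have hfa : ∀ x, f x = F.mulVec x := fun x => Matrix.toLin'_apply F x
  have hdvd : (∏ j, (Polynomial.X - Polynomial.C (-(lam j)))) ∣ f.charpoly := by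
    rw [hf, Matrix.charpoly_toLin', hchar, Finset.prod_mul_distrib]
    simp
  obtain ⟨Y₀, hY₀, hflag₀⟩ := exists_flag n _ f _ hdvd
  let H : ((Fin n ⊕ Fin n) → ℂ) → ((Fin n ⊕ Fin n) → ℂ) →ₗ[ℂ] ℂ := fun X =>
    (-Complex.I) • sympLin (star X)
  have hH : ∀ X Y, H X Y = -Complex.I * sympForm (star X) Y := fun X Y => rfl
  obtain ⟨Y, hYo, hYs, hYf⟩ := exists_ortho_flag H (by
      intro x y
      rw [hH, hH, star_mul', star_sympForm, star_star, sympForm_swap x (star y)]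
      simp) f (by
      intro z hz
      rw [hH, hfa, hF]
      have := qPolar_star_pos A B C hAs hCs hpos z hz
      rw [← mul_assoc]
      simpa using this) n Y₀ lam hlam hY₀ (by simpa using hflag₀)
  have hskew : ∀ X Y, sympForm (F.mulVec X) Y = - sympForm X (F.mulVec Y) := by
    intro X Y
    rw [sympForm_swap, hF, hF, qPolar_symm A B C hAs hCs]
  have hYrange : ∀ k, F.mulVec (Y k) ∈ Submodule.span ℂ (Set.range Y) := by
    intro k
    have h1 := Submodule.span_mono (Set.image_subset_range Y {i | i < k}) (hYf k)
    have h2 := Submodule.smul_mem _ (lam k) (Submodule.subset_span (R := ℂ) (Set.mem_range_self (f := Y) k))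
    have := Submodule.sub_mem _ h1 h2
    rw [add_sub_cancel_right, hfa] at this
    exact this
  have hlow : ∀ j k, k ≤ j → ∀ w ∈ Submodule.span ℂ (Y '' {i | i < k}), H (Y j) w = 0 := by
    intro j k hjk w hw
    induction hw using Submodule.span_induction with
    | mem x hx =>
      obtain ⟨i, hi, rfl⟩ := hx
      rw [hYo, if_neg]
      rintro rfl
      exact absurd hi (not_lt.2 hjk)
    | zero => simp
    | add x y _ _ hx hy => rw [map_add, hx, hy, add_zero]
    | smul a x _ hx => rw [map_smul, hx, smul_zero]
  have hT : ∀ j k, k ≤ j → H (Y j) (F.mulVec (Y k)) = - (if j = k then lam k else 0) := by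
    intro j k hjk
    have := hlow j k hjk _ (hYf k)
    rw [map_add, map_smul, hfa, hYo] at this
    rw [eq_neg_of_add_eq_zero_left this]
    split_ifs <;> simp
  refine ⟨Y, fun j k => - H (Y j) (F.mulVec (Y k)), ?_, ?_, ?_, ?_, ?_⟩
  · intro j k hjk
    beta_reduce
    rw [hT j k hjk.le, if_neg hjk.ne', neg_zero, neg_zero]
  · intro j
    beta_reduce
    rw [hT j j le_rfl, if_pos rfl, neg_neg]
  · intro k
    rw [← Finset.sum_neg_distrib]
    simp only [neg_smul, neg_neg]
    exact span_expand H Y hYo _ (hYrange k)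
  · -- isotropy
    have main : ∀ p : ℕ, ∀ j k : Fin n, (j : ℕ) + k < p → sympForm (Y j) (Y k) = 0 := by
      intro p
      induction p with
      | zero => intro j k h; omega
      | succ p ihp =>
        intro j k hjk
        have hk : ∀ w ∈ Submodule.span ℂ (Y '' {i | i < k}), sympForm (Y j) w = 0 := by
          intro w hw
          induction hw using Submodule.span_induction with
          | mem x hx =>
            obtain ⟨i, hi, rfl⟩ := hx
            have hi' : (i : ℕ) < k := hi
            exact ihp j i (by omega)
          | zero => simp [sympForm]
          | add x y _ _ hx hy => rw [sympForm_add_right, hx, hy, add_zero]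
          | smul a x _ hx => rw [sympForm_smul_right, hx, mul_zero]
        have hj : ∀ w ∈ Submodule.span ℂ (Y '' {i | i < j}), sympForm (Y k) w = 0 := by
          intro w hw
          induction hw using Submodule.span_induction with
          | mem x hx =>
            obtain ⟨i, hi, rfl⟩ := hx
            have hi' : (i : ℕ) < j := hi
            rw [sympForm_swap, ihp i k (by omega), neg_zero]
          | zero => simp [sympForm]
          | add x y _ _ hx hy => rw [sympForm_add_right, hx, hy, add_zero]
          | smul a x _ hx => rw [sympForm_smul_right, hx, mul_zero]
        have h1 := hk _ (hYf k)
        have h2 := hj _ (hYf j)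
        rw [hfa, sympForm_add_right, sympForm_smul_right] at h1 h2
        rw [sympForm_swap, hskew, sympForm_swap (Y k) (Y j)] at h2
        have h3 : (lam j + lam k) * sympForm (Y j) (Y k) = 0 := by linear_combination h1 - h2
        refine (mul_eq_zero.1 h3).resolve_left ?_
        intro h4
        have h5 := congrArg Complex.im h4
        simp at h5
        have := hlam j
        have := hlam k
        linarith
    exact fun j k => main _ j k (Nat.lt_succ_self _)
  · intro j k
    have := hYo j k
    rw [hH] at this
    have h2 : sympForm (star (Y j)) (Y k) = Complex.I * (-Complex.I * sympForm (star (Y j)) (Y k)) := by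
      rw [← mul_assoc]; simp
    rw [h2, this]
    split_ifs <;> simp

end QRes


namespace QRes

/-- Abstract algebra of creation and annihilation operators on a dense space of vectors. -/
structure Ladder (n : ℕ) (V H : Type) [AddCommGroup V] [Module ℂ V]
    [NormedAddCommGroup H] [InnerProductSpace ℂ H] where
  ι : V →ₗ[ℂ] H
  b : Fin n → Module.End ℂ V
  bs : Fin n → Module.End ℂ V
  adj : ∀ j u v, inner ℂ (ι (bs j u)) (ι v) = inner ℂ (ι u) (ι (b j v))
  ccr : ∀ j k u, b j (bs k u) = bs k (b j u) + if j = k then u else 0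
  comm : ∀ j k, Commute (bs j) (bs k)
  g : V
  bg : ∀ j, b j g = 0
  gnorm : ‖ι g‖ = 1
  complete : ∀ E : Submodule ℂ V, g ∈ E → (∀ j, ∀ u ∈ E, b j u ∈ E ∧ bs j u ∈ E) →
    ∀ v : H, (∀ u ∈ E, inner ℂ (ι u) v = 0) → v = 0

namespace Ladder

variable {n : ℕ} {V H : Type} [AddCommGroup V] [Module ℂ V]
    [NormedAddCommGroup H] [InnerProductSpace ℂ H] (L : Ladder n V H)

theorem mon_comm : Pairwise fun i j => ∀ (x y : Multiplicative ℕ),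
    Commute (powersHom (Module.End ℂ V) (L.bs i) x) (powersHom (Module.End ℂ V) (L.bs j) y) := by
  intro i j _ x y
  simp only [powersHom_apply]
  exact (L.comm i j).pow_pow _ _

/-- The product of powers of creation operators, as a monoid morphism. -/
noncomputable def mon : (Fin n → Multiplicative ℕ) →* Module.End ℂ V :=
  MonoidHom.noncommPiCoprod (fun j => powersHom (Module.End ℂ V) (L.bs j))
    L.mon_comm

/-- Unnormalized Hermite vectors. -/
noncomputable def psi (α : Fin n → ℕ) : V := L.mon (fun j => Multiplicative.ofAdd (α j)) L.g

/-- unit multi-index -/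
def e (j : Fin n) : Fin n → ℕ := Pi.single j 1

theorem psi_zero : L.psi 0 = L.g := by
  have : (fun j : Fin n => Multiplicative.ofAdd ((0 : Fin n → ℕ) j)) = 1 := rfl
  rw [psi, this, map_one]; rfl

theorem psi_add (α : Fin n → ℕ) (j : Fin n) : L.psi (α + e j) = L.bs j (L.psi α) := by
  have h : (fun i : Fin n => Multiplicative.ofAdd ((α + e j) i))
      = Pi.mulSingle j (Multiplicative.ofAdd 1) * (fun i => Multiplicative.ofAdd (α i)) := by
    funext i
    simp only [Pi.mul_apply, Pi.add_apply, ofAdd_add]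
    rw [mul_comm]
    by_cases hij : i = j
    · subst hij; simp [e]
    · simp [e, hij]
  rw [psi, h, map_mul, Module.End.mul_apply]
  congr 1
  have := MonoidHom.noncommPiCoprod_mulSingle (M := Module.End ℂ V)
    (fun j => powersHom (Module.End ℂ V) (L.bs j)) (hcomm := mon_comm L) j (Multiplicative.ofAdd 1)
  unfold mon
  rw [this]
  simp

theorem index_cases (α : Fin n → ℕ) : α = 0 ∨ ∃ j β, α = β + e j := by
  by_cases h : α = 0
  · exact Or.inl h
  · right
    obtain ⟨j, hj⟩ := Function.ne_iff.1 h
    refine ⟨j, α - e j, ?_⟩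
    funext i
    by_cases hij : i = j
    · subst hij
      simp [e] at hj ⊢; omega
    · simp [e, hij]

theorem sum_e (j : Fin n) : ∑ i, e j i = 1 := by
  simp [e]

theorem sum_add_e (α : Fin n → ℕ) (j : Fin n) : ∑ i, (α + e j) i = (∑ i, α i) + 1 := by
  simp only [Pi.add_apply, Finset.sum_add_distrib, sum_e]

theorem index_ind {P : (Fin n → ℕ) → Prop} (h0 : P 0) (h1 : ∀ j α, P α → P (α + e j)) :
    ∀ α, P α := by
  have : ∀ m, ∀ α : Fin n → ℕ, ∑ i, α i = m → P α := by
    intro m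
    induction m with
    | zero =>
      intro α hα
      rcases index_cases α with rfl | ⟨j, β, rfl⟩
      · exact h0
      · rw [sum_add_e] at hα; omega
    | succ m ih =>
      intro α hα
      rcases index_cases α with rfl | ⟨j, β, rfl⟩
      · exact h0
      · rw [sum_add_e] at hα
        exact h1 _ _ (ih β (by omega))
  exact fun α => this _ α rfl

theorem add_e_sub (α : Fin n → ℕ) (j : Fin n) : α + e j - e j = α := by
  funext i; simp

theorem sub_add_e {α : Fin n → ℕ} {j : Fin n} (h : α j ≠ 0) : α - e j + e j = α := by
  funext i
  by_cases hij : i = j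
  · subst hij; simp [e]; omega
  · simp [e, hij]

theorem e_self (j : Fin n) : e j j = 1 := by simp [e]
theorem e_ne {j k : Fin n} (h : j ≠ k) : e k j = 0 := by simp [e, h]

theorem b_psi (α : Fin n → ℕ) : ∀ j, L.b j (L.psi α) = (α j : ℂ) • L.psi (α - e j) := by
  refine index_ind (P := fun α => ∀ j, L.b j (L.psi α) = (α j : ℂ) • L.psi (α - e j)) ?_ ?_ α
  · intro j; simp [psi_zero, L.bg]
  · intro k α ih j
    rw [psi_add, L.ccr, ih, map_smul, ← psi_add]
    by_cases hjk : j = k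
    · subst hjk
      rw [if_pos rfl, add_e_sub]
      by_cases h : α j = 0
      · simp [h, e_self]
      · rw [sub_add_e h]
        simp [e_self, add_smul]
    · rw [if_neg hjk, add_zero]
      simp only [Pi.add_apply, e_ne hjk, add_zero]
      by_cases h : α j = 0
      · simp [h]
      · congr 2
        funext i
        by_cases hij : i = j
        · subst hij; simp [e_self, e_ne hjk]
        · simp [e_ne hij]

/-- multi-index factorial -/
def fac (α : Fin n → ℕ) : ℕ := ∏ j, (α j).factorial

theorem fac_pos (α : Fin n → ℕ) : 0 < fac α := Finset.prod_pos fun _ _ => Nat.factorial_pos _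

theorem fac_add (α : Fin n → ℕ) (j : Fin n) : fac (α + e j) = (α j + 1) * fac α := by
  unfold fac
  rw [← Finset.mul_prod_erase _ _ (Finset.mem_univ j), ← Finset.mul_prod_erase _ (fun i => (α i).factorial) (Finset.mem_univ j), ← mul_assoc]
  congr 1
  · simp [e_self, Nat.factorial_succ]
  · refine Finset.prod_congr rfl fun i hi => ?_
    simp [e_ne (Finset.ne_of_mem_erase hi)]

/-- coefficient functional -/
noncomputable def d (α : Fin n → ℕ) (u : V) : ℂ := inner ℂ (L.ι (L.psi α)) (L.ι u)

theorem d_add (α) (u v : V) : L.d α (u + v) = L.d α u + L.d α v := by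
  simp [d]

theorem d_sub (α) (u v : V) : L.d α (u - v) = L.d α u - L.d α v := by
  simp [d]

theorem d_smul (α) (c : ℂ) (u : V) : L.d α (c • u) = c * L.d α u := by
  simp [d]

theorem d_sum {κ : Type*} (s : Finset κ) (α) (u : κ → V) :
    L.d α (∑ i ∈ s, u i) = ∑ i ∈ s, L.d α (u i) := by
  simp [d]

theorem d_b (α j) (u : V) : L.d α (L.b j u) = L.d (α + e j) u := by
  rw [d, d, psi_add, L.adj]

theorem adj' (j) (u v : V) : inner ℂ (L.ι (L.b j u)) (L.ι v) = inner ℂ (L.ι u) (L.ι (L.bs j v)) := by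
  rw [← inner_conj_symm, ← L.adj, inner_conj_symm]

theorem d_bs (α j) (u : V) : L.d α (L.bs j u) = (α j : ℂ) * L.d (α - e j) u := by
  rw [d, d, ← adj', b_psi, map_smul, inner_smul_left]
  simp

theorem d_psi (α : Fin n → ℕ) : ∀ β, L.d α (L.psi β) = if α = β then (fac α : ℂ) else 0 := by
  refine index_ind (P := fun α => ∀ β, L.d α (L.psi β) = if α = β then (fac α : ℂ) else 0) ?_ ?_ α
  · intro β
    rcases index_cases β with rfl | ⟨j, β, rfl⟩
    · rw [if_pos rfl, d, psi_zero, inner_self_eq_norm_sq_to_K, L.gnorm]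
      simp [fac]
    · rw [if_neg, psi_add, d_bs]
      · simp
      · intro h
        have := congrFun h j
        simp [e_self] at this
  · intro j α ih β
    rw [← d_b, b_psi, d_smul, ih]
    by_cases h : β j = 0
    · rw [if_neg (c := α + e j = β), h]
      · simp
      · intro h'
        have := congrFun h' j
        simp [e_self] at this
        omega
    · by_cases h' : α = β - e j
      · rw [if_pos h', if_pos]
        · rw [fac_add, h']
          simp only [Pi.sub_apply, e_self]
          rw [Nat.sub_add_cancel (by omega)]; push_cast; rfl
        · rw [h', sub_add_e h]
      · rw [if_neg h', if_neg, mul_zero]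
        rintro rfl
        rw [add_e_sub] at h'
        exact h' rfl

theorem norm_psi (α : Fin n → ℕ) : ‖L.ι (L.psi α)‖ = √(fac α) := by
  have h := L.d_psi α α
  rw [if_pos rfl, d, inner_self_eq_norm_sq_to_K] at h
  have h2 : ‖L.ι (L.psi α)‖ ^ 2 = (fac α : ℝ) := by
    apply Complex.ofReal_injective
    rw [Complex.ofReal_pow]
    exact h
  rw [← h2, Real.sqrt_sq (norm_nonneg _)]

theorem hasSum_d [CompleteSpace H] (u : V) :
    HasSum (fun α => ‖L.d α u‖ ^ 2 / fac α) (‖L.ι u‖ ^ 2) := by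
  classical
  let ε : (Fin n → ℕ) → H := fun α => (((√(fac α))⁻¹ : ℝ) : ℂ) • L.ι (L.psi α)
  have hε : Orthonormal ℂ ε := by
    rw [orthonormal_iff_ite]
    intro α β
    simp only [ε]
    rw [inner_smul_left, inner_smul_right]
    have := L.d_psi α β
    rw [d] at this
    rw [this]
    split_ifs with h
    · subst h
      have h1 : (0:ℝ) < fac α := by exact_mod_cast fac_pos α
      have : ((√(fac α))⁻¹ : ℝ) * (√(fac α))⁻¹ * (fac α) = 1 := by
        rw [← mul_inv, Real.mul_self_sqrt h1.le, inv_mul_cancel₀ h1.ne']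
      rw [Complex.conj_ofReal, ← mul_assoc]
      exact_mod_cast this
    · simp
  have hbot : (Submodule.span ℂ (Set.range ε))ᗮ = ⊥ := by
    rw [Submodule.eq_bot_iff]
    intro v hv
    have hψ : ∀ α, inner ℂ (L.ι (L.psi α)) v = 0 := by
      intro α
      have h1 := (Submodule.mem_orthogonal _ _).1 hv (ε α) (Submodule.subset_span ⟨α, rfl⟩)
      simp only [ε] at h1
      rw [inner_smul_left] at h1
      rcases mul_eq_zero.1 h1 with h | h
      · exfalso
        have h1 : (0:ℝ) < fac α := by exact_mod_cast fac_pos α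
        rw [Complex.conj_ofReal] at h
        have h2 : (√(fac α))⁻¹ = 0 := by exact_mod_cast h
        exact (inv_ne_zero (Real.sqrt_pos.2 h1).ne') h2
      · exact h
    refine L.complete (Submodule.span ℂ (Set.range L.psi)) ?_ ?_ v ?_
    · rw [← psi_zero]; exact Submodule.subset_span ⟨0, rfl⟩
    · intro j u hu
      induction hu using Submodule.span_induction with
      | mem x hx =>
        obtain ⟨α, rfl⟩ := hx
        rw [b_psi, ← psi_add]
        exact ⟨Submodule.smul_mem _ _ (Submodule.subset_span ⟨_, rfl⟩),
          Submodule.subset_span ⟨_, rfl⟩⟩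
      | zero => simp
      | add x y _ _ hx hy =>
        rw [map_add, map_add]
        exact ⟨Submodule.add_mem _ hx.1 hy.1, Submodule.add_mem _ hx.2 hy.2⟩
      | smul a x _ hx =>
        rw [map_smul, map_smul]
        exact ⟨Submodule.smul_mem _ _ hx.1, Submodule.smul_mem _ _ hx.2⟩
    · intro u hu
      induction hu using Submodule.span_induction with
      | mem x hx =>
        obtain ⟨α, rfl⟩ := hx
        exact hψ α
      | zero => simp
      | add x y _ _ hx hy => rw [map_add, inner_add_left, hx, hy, add_zero]
      | smul a x _ hx => rw [map_smul, inner_smul_left, hx, mul_zero]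
  let B := HilbertBasis.mkOfOrthogonalEqBot hε hbot
  have hB : ∀ α, B α = ε α := fun α => by simp [B]
  have key := B.hasSum_inner_mul_inner (L.ι u) (L.ι u)
  rw [inner_self_eq_norm_sq_to_K] at key
  have h2 : ∀ α, inner ℂ (L.ι u) (B α) * inner ℂ (B α) (L.ι u)
      = ((‖L.d α u‖ ^ 2 / fac α : ℝ) : ℂ) := by
    intro α
    rw [← inner_conj_symm, mul_comm, Complex.mul_conj, Complex.normSq_eq_norm_sq, hB]
    simp only [ε]
    rw [inner_smul_left, norm_mul, mul_pow]
    congr 1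
    rw [Complex.conj_ofReal, Complex.norm_real, Real.norm_eq_abs, sq_abs, inv_pow,
      Real.sq_sqrt (Nat.cast_nonneg _), mul_comm, div_eq_mul_inv]
    rfl
  simp only [h2] at key
  have key' : HasSum (fun α => ((‖L.d α u‖ ^ 2 / fac α : ℝ) : ℂ)) ((‖L.ι u‖ ^ 2 : ℝ) : ℂ) := by
    rw [Complex.ofReal_pow]
    exact key
  exact_mod_cast key'

theorem high_bound [CompleteSpace H] (N : ℕ) (u : V) (hu : ∀ α, ∑ i, α i ≤ N → L.d α u = 0) :
    (N + 1 : ℝ) * ‖L.ι u‖ ^ 2 ≤ ∑ j, ‖L.ι (L.b j u)‖ ^ 2 := by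
  have h1 : ∀ j, HasSum (fun β : Fin n → ℕ => (β j : ℝ) * (‖L.d β u‖ ^ 2 / fac β))
      (‖L.ι (L.b j u)‖ ^ 2) := by
    intro j
    have hinj : Function.Injective (fun α : Fin n → ℕ => α + e j) := add_left_injective _
    rw [← hinj.hasSum_iff]
    · convert L.hasSum_d (L.b j u) using 2 with α
      simp only [Function.comp, fac_add, d_b, Pi.add_apply, e_self]
      have : (0:ℝ) < fac α := by exact_mod_cast fac_pos α
      push_cast
      field_simp
    · intro β hβ
      have : β j = 0 := by
        by_contra h
        exact hβ ⟨β - e j, sub_add_e h⟩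
      simp [this]
  have h2 := hasSum_sum (s := Finset.univ) fun j _ => h1 j
  refine hasSum_le ?_ ((L.hasSum_d u).mul_left (N + 1 : ℝ)) h2
  intro β
  rw [← Finset.sum_mul]
  by_cases hβ : ∑ i, β i ≤ N
  · simp [hu β hβ]
  · gcongr
    have : N + 1 ≤ ∑ i, β i := by omega
    exact_mod_cast this

end Ladder
end QRes


namespace QRes
namespace Ladder

variable {n : ℕ} {V H : Type} [AddCommGroup V] [Module ℂ V]
    [NormedAddCommGroup H] [InnerProductSpace ℂ H] (L : Ladder n V H)

/-- The quadratic operator in normal form. -/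
noncomputable def Qop (κ : ℂ) (M S : Fin n → Fin n → ℂ) (u : V) : V :=
  κ • u + ∑ j, ∑ k, M j k • L.bs j (L.b k u) + ∑ j, ∑ k, S j k • L.bs j (L.bs k u)

theorem Qop_sub (κ : ℂ) (M S : Fin n → Fin n → ℂ) (u v : V) :
    L.Qop κ M S (u - v) = L.Qop κ M S u - L.Qop κ M S v := by
  simp only [Qop, map_sub, smul_sub, Finset.sum_sub_distrib]
  abel

theorem Qop_add (κ : ℂ) (M S : Fin n → Fin n → ℂ) (u v : V) :
    L.Qop κ M S (u + v) = L.Qop κ M S u + L.Qop κ M S v := by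
  simp only [Qop, map_add, smul_add, Finset.sum_add_distrib]
  abel

theorem Qop_sum {ι' : Type*} (s : Finset ι') (κ : ℂ) (M S : Fin n → Fin n → ℂ) (u : ι' → V) :
    L.Qop κ M S (∑ i ∈ s, u i) = ∑ i ∈ s, L.Qop κ M S (u i) := by
  classical
  induction s using Finset.induction_on with
  | empty => simp [Qop]
  | insert a s ha ih => rw [Finset.sum_insert ha, Finset.sum_insert ha, Qop_add, ih]

theorem Qop_smul (κ : ℂ) (M S : Fin n → Fin n → ℂ) (c : ℂ) (u : V) :
    L.Qop κ M S (c • u) = c • L.Qop κ M S u := by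
  simp only [Qop, map_smul, smul_add, Finset.smul_sum]
  simp only [smul_comm c]

theorem d_Qop (κ : ℂ) (M S : Fin n → Fin n → ℂ) (α) (u : V) :
    L.d α (L.Qop κ M S u) = κ * L.d α u
      + ∑ j, ∑ k, M j k * ((α j : ℂ) * L.d (α - e j + e k) u)
      + ∑ j, ∑ k, S j k * ((α j : ℂ) * (((α - e j) k : ℕ) * L.d (α - e j - e k) u)) := by
  simp only [Qop, d_add, d_smul, d_sum, d_bs, d_b]

/-- weights -/
noncomputable def wt (N : ℕ) (t : ℝ) (j : Fin n) : ℝ := √N * t ^ (n - (j : ℕ))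

/-- multiplicative weights -/
noncomputable def om (N : ℕ) (t : ℝ) (α : Fin n → ℕ) : ℝ := ∏ j, wt N t j ^ α j

theorem om_add (N : ℕ) (t : ℝ) (α : Fin n → ℕ) (k) : om N t (α + e k) = om N t α * wt N t k := by
  unfold om
  simp only [Pi.add_apply, pow_add, Finset.prod_mul_distrib]
  congr 1
  rw [Finset.prod_eq_single k]
  · simp [e_self]
  · intro j _ hj; simp [e_ne hj]
  · simp

variable {N : ℕ} {t : ℝ}

theorem wt_pos (hN : 1 ≤ N) (ht : 1 ≤ t) (j : Fin n) : 0 < wt N t j := by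
  unfold wt
  have : (0:ℝ) < N := by exact_mod_cast hN
  positivity

theorem om_pos (hN : 1 ≤ N) (ht : 1 ≤ t) (α : Fin n → ℕ) : 0 < om N t α :=
  Finset.prod_pos fun j _ => pow_pos (wt_pos hN ht j) _

theorem wt_ge (hN : 1 ≤ N) (ht : 1 ≤ t) (j : Fin n) : √N * t ≤ wt N t j := by
  unfold wt
  have h : n - (j:ℕ) ≠ 0 := by have := j.2; omega
  gcongr
  exact le_self_pow₀ ht h

theorem wt_lt (hN : 1 ≤ N) (ht : 1 ≤ t) {j k : Fin n} (hjk : j < k) : wt N t k * t ≤ wt N t j := by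
  unfold wt
  rw [mul_assoc, ← pow_succ]
  have h1 : (j : ℕ) < k := hjk
  have h2 := k.2
  gcongr
  omega

theorem sqrt_fac_le (hN : 1 ≤ N) (ht : 1 ≤ t) (α : Fin n → ℕ) (hα : ∑ j, α j ≤ N) :
    √(fac α) ≤ om N t α := by
  have h1 : (fac α : ℝ) ≤ ∏ j, (N : ℝ) ^ α j := by
    unfold fac
    push_cast
    refine Finset.prod_le_prod (fun _ _ => by positivity) fun j _ => ?_
    have : α j ≤ N := le_trans (Finset.single_le_sum (f := α) (fun _ _ => Nat.zero_le _) (Finset.mem_univ j)) hα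
    have h := (Nat.factorial_le_pow (α j)).trans (Nat.pow_le_pow_left this (α j))
    exact_mod_cast h
  rw [Real.sqrt_le_iff]
  refine ⟨(om_pos hN ht α).le, h1.trans ?_⟩
  unfold om
  rw [← Finset.prod_pow]
  refine Finset.prod_le_prod (fun _ _ => by positivity) fun j _ => ?_
  rw [← pow_mul, mul_comm (α j) 2, pow_mul]
  gcongr
  have h2 := wt_ge hN ht j
  have h3 : √N ≤ wt N t j := le_trans (le_mul_of_one_le_right (Real.sqrt_nonneg _) ht) h2
  calc (N:ℝ) = √N ^ 2 := (Real.sq_sqrt (Nat.cast_nonneg _)).symm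
    _ ≤ _ := by gcongr

theorem om_le (hN : 1 ≤ N) (ht : 1 ≤ t) (α : Fin n → ℕ) (hα : ∑ j, α j ≤ N) :
    om N t α ≤ √(fac α) * (Real.exp (n * N) * t ^ (n * N)) := by
  have key : ∀ j, wt N t j ^ α j ≤ √((α j).factorial) * (Real.exp N * t ^ (n * α j)) := by
    intro j
    have h1 : (√N : ℝ) ^ α j ≤ √((α j).factorial) * Real.exp N := by
      have h := Real.pow_div_factorial_le_exp (N : ℝ) (Nat.cast_nonneg _) (α j)
      have hp : (0:ℝ) < (α j).factorial := by exact_mod_cast Nat.factorial_pos _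
      rw [div_le_iff₀ hp] at h
      refine le_of_sq_le_sq ?_ (by positivity) 
      rw [mul_pow, Real.sq_sqrt hp.le, ← pow_mul, mul_comm (α j) 2, pow_mul, Real.sq_sqrt (Nat.cast_nonneg _)]
      refine h.trans ?_
      rw [mul_comm]
      gcongr
      refine le_self_pow₀ (Real.one_le_exp (Nat.cast_nonneg _)) (by norm_num)
    unfold wt
    rw [mul_pow, ← pow_mul, ← mul_assoc]
    gcongr
    omega
  unfold om fac
  refine (Finset.prod_le_prod (fun j _ => (pow_pos (wt_pos hN ht j) _).le) fun j _ => key j).trans ?_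
  rw [Finset.prod_mul_distrib, Finset.prod_mul_distrib]
  push_cast
  rw [Real.sqrt_prod _ (fun _ _ => by positivity)]
  gcongr
  · simp [Real.exp_nat_mul]
  · rw [Finset.prod_pow_eq_pow_sum, ← Finset.mul_sum]
    gcongr

/-- total size of the coefficients -/
noncomputable def csum (M S : Fin n → Fin n → ℂ) : ℝ := ∑ j, ∑ k, (‖M j k‖ + ‖S j k‖)

/-- low indices -/
def low (n N : ℕ) : Finset (Fin n → ℕ) :=
  (Fintype.piFinset fun _ => Finset.range (N + 1)).filter fun α => ∑ j, α j ≤ N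

theorem mem_low {α : Fin n → ℕ} : α ∈ low n N ↔ ∑ j, α j ≤ N := by
  simp only [low, Finset.mem_filter, Fintype.mem_piFinset, Finset.mem_range, and_iff_right_iff_imp]
  intro h j
  have := Finset.single_le_sum (f := α) (fun _ _ => Nat.zero_le _) (Finset.mem_univ j)
  omega

theorem card_low : (low n N).card ≤ (N + 1) ^ n := by
  refine (Finset.card_filter_le _ _).trans ?_
  simp

theorem low_bound (hN : 1 ≤ N) (ht : 1 ≤ t) (κ w : ℂ) (M S : Fin n → Fin n → ℂ)
    (hM : ∀ j k, k < j → M j k = 0) (D : ℝ) (hD : 0 < D)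
    (hw : ∀ α : Fin n → ℕ, D ≤ ‖κ + ∑ j, M j j * α j - w‖)
    (hC : csum M S * N / t ≤ D / 2) (u : V) (α : Fin n → ℕ) (hα : ∑ j, α j ≤ N) :
    ‖L.d α u‖ ≤ om N t α * (2 / D * ‖L.ι (L.Qop κ M S u - w • u)‖) := by
  have ht0 : 0 < t := by linarith
  have hN0 : (0:ℝ) < N := by exact_mod_cast hN
  set f := L.Qop κ M S u - w • u with hf
  obtain ⟨β, hβ, hmax⟩ := Finset.exists_max_image (low n N) (fun α => ‖L.d α u‖ / om N t α)
    ⟨0, mem_low.2 (by simp)⟩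
  rw [mem_low] at hβ
  set r := ‖L.d β u‖ / om N t β with hr
  have hr0 : 0 ≤ r := by have := om_pos hN ht β; positivity
  have hrb : ∀ γ : Fin n → ℕ, ∑ j, γ j ≤ N → ‖L.d γ u‖ ≤ r * om N t γ := by
    intro γ hγ
    have := hmax γ (mem_low.2 hγ)
    rwa [div_le_iff₀ (om_pos hN ht γ)] at this
  have hβr : ‖L.d β u‖ = r * om N t β := by
    rw [hr, div_mul_cancel₀ _ (om_pos hN ht β).ne']
  -- equation
  have heq : (κ + ∑ j, M j j * β j - w) * L.d β u = L.d β f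
      - ∑ j, ∑ k, (if j = k then 0 else M j k) * ((β j : ℂ) * L.d (β - e j + e k) u)
      - ∑ j, ∑ k, S j k * ((β j : ℂ) * (((β - e j) k : ℕ) * L.d (β - e j - e k) u)) := by
    rw [hf, d_sub, d_smul, d_Qop]
    have : ∑ j, ∑ k, M j k * ((β j : ℂ) * L.d (β - e j + e k) u)
      = ∑ j, M j j * β j * L.d β u + ∑ j, ∑ k, (if j = k then 0 else M j k) * ((β j : ℂ) * L.d (β - e j + e k) u) := by
      rw [← Finset.sum_add_distrib]
      refine Finset.sum_congr rfl fun j _ => ?_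
      have h1 : M j j * β j * L.d β u = ∑ k, (if j = k then M j k else 0) * ((β j : ℂ) * L.d (β - e j + e k) u) := by
        simp only [ite_mul, zero_mul, Finset.sum_ite_eq, Finset.mem_univ, if_true]
        by_cases h : β j = 0
        · simp [h]
        · rw [sub_add_e h, mul_assoc]
      rw [h1, ← Finset.sum_add_distrib]
      refine Finset.sum_congr rfl fun k _ => ?_
      split_ifs <;> simp
    rw [this, ← Finset.sum_mul]
    ring
  have hbj : ∀ j, (β j : ℝ) ≤ N := fun j => by
    have := Finset.single_le_sum (f := β) (fun _ _ => Nat.zero_le _) (Finset.mem_univ j)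
    exact_mod_cast this.trans hβ
  have hωβ := om_pos hN ht β
  have e1 : ∀ j k, ‖(if j = k then 0 else M j k) * ((β j : ℂ) * L.d (β - e j + e k) u)‖
      ≤ ‖M j k‖ * (N / t * (r * om N t β)) := by
    intro j k
    rcases lt_trichotomy j k with h | h | h
    · rw [if_neg h.ne, norm_mul]
      gcongr
      by_cases hj : β j = 0
      · simp [hj]; positivity
      · rw [norm_mul, Complex.norm_natCast]
        have hs : ∑ i, (β - e j + e k) i ≤ N := by
          have h2 := sum_add_e (β - e j) j
          rw [sub_add_e hj] at h2
          rw [sum_add_e]; omega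
        have h3 := hrb _ hs
        rw [om_add] at h3
        have h4 := om_add N t (β - e j) j
        rw [sub_add_e hj] at h4
        have h5 := wt_lt hN ht h
        have h6 := om_pos hN ht (β - e j)
        calc (β j : ℝ) * ‖L.d (β - e j + e k) u‖ ≤ N * (r * (om N t (β - e j) * wt N t k)) := by
              have := hbj j
              gcongr
          _ ≤ N * (r * (om N t (β - e j) * (wt N t j / t))) := by
              gcongr
              rwa [le_div_iff₀ ht0]
          _ = _ := by rw [h4]; ring
    · subst h; simp; positivity
    · rw [if_neg h.ne', hM _ _ h]; simp
  have e2 : ∀ j k, ‖S j k * ((β j : ℂ) * (((β - e j) k : ℕ) * L.d (β - e j - e k) u))‖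
      ≤ ‖S j k‖ * (N / t * (r * om N t β)) := by
    intro j k
    rw [norm_mul]
    gcongr
    by_cases hj : β j = 0
    · simp [hj]; positivity
    by_cases hk : (β - e j) k = 0
    · rw [hk]; simp; positivity
    rw [norm_mul, norm_mul, Complex.norm_natCast, Complex.norm_natCast]
    have h2 := sum_add_e (β - e j) j
    rw [sub_add_e hj] at h2
    have h2' := sum_add_e (β - e j - e k) k
    rw [sub_add_e hk] at h2'
    have h3 := hrb (β - e j - e k) (by omega)
    have h4 := om_add N t (β - e j) j
    rw [sub_add_e hj] at h4
    have h4' := om_add N t (β - e j - e k) k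
    rw [sub_add_e hk] at h4'
    have h6 := om_pos hN ht (β - e j - e k)
    have h7 := wt_ge hN ht j
    have h8 := wt_ge hN ht k
    have hb2 : (((β - e j) k : ℕ) : ℝ) ≤ N := by
      refine le_trans ?_ (hbj k)
      exact_mod_cast Nat.sub_le _ _
    have h9 : (N : ℝ) * t ≤ wt N t k * wt N t j := by
      calc (N : ℝ) * t ≤ (N : ℝ) * t * t := le_mul_of_one_le_right (by positivity) ht
        _ = (√N * √N) * t * t := by rw [Real.mul_self_sqrt hN0.le]
        _ = (√N * t) * (√N * t) := by ring
        _ ≤ _ := by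
          have := wt_pos hN ht k
          gcongr
    calc (β j : ℝ) * ((((β - e j) k : ℕ) : ℝ) * ‖L.d (β - e j - e k) u‖)
        ≤ N * (N * (r * om N t (β - e j - e k))) := by
          have := hbj j
          gcongr
      _ = N / t * (r * (om N t (β - e j - e k) * (N * t))) := by field_simp
      _ ≤ N / t * (r * (om N t (β - e j - e k) * (wt N t k * wt N t j))) := by gcongr
      _ = _ := by rw [h4, h4']; ring
  have e3 : ‖L.d β f‖ ≤ om N t β * ‖L.ι f‖ := by
    refine (norm_inner_le_norm _ _).trans ?_
    rw [norm_psi]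
    gcongr
    exact sqrt_fac_le hN ht β hβ
  have e4 : D * (r * om N t β) ≤ om N t β * ‖L.ι f‖ + csum M S * (N / t * (r * om N t β)) := by
    calc D * (r * om N t β) ≤ ‖κ + ∑ j, M j j * β j - w‖ * (r * om N t β) := by
          gcongr; exact hw β
      _ = ‖(κ + ∑ j, M j j * β j - w) * L.d β u‖ := by rw [norm_mul, hβr]
      _ ≤ ‖L.d β f‖ + (∑ j, ∑ k, ‖M j k‖ * (N / t * (r * om N t β)))
          + (∑ j, ∑ k, ‖S j k‖ * (N / t * (r * om N t β))) := by
          rw [heq]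
          refine (norm_sub_le _ _).trans ?_
          refine add_le_add ((norm_sub_le _ _).trans (add_le_add le_rfl ?_)) ?_
          · exact norm_sum_le_of_le _ fun j _ => norm_sum_le_of_le _ fun k _ => e1 j k
          · exact norm_sum_le_of_le _ fun j _ => norm_sum_le_of_le _ fun k _ => e2 j k
      _ = ‖L.d β f‖ + csum M S * (N / t * (r * om N t β)) := by
          unfold csum
          simp only [Finset.sum_mul, add_mul, Finset.sum_add_distrib]
          ring
      _ ≤ _ := by gcongr
  have e5 : D * r ≤ ‖L.ι f‖ + D / 2 * r := by
    have h1 : csum M S * (N / t * (r * om N t β)) ≤ D / 2 * (r * om N t β) := by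
      calc _ = csum M S * N / t * (r * om N t β) := by ring
        _ ≤ _ := by gcongr
    have h2 : om N t β * (D * r) ≤ om N t β * (‖L.ι f‖ + D / 2 * r) := by nlinarith
    exact le_of_mul_le_mul_left h2 hωβ
  have e6 : r ≤ 2 / D * ‖L.ι f‖ := by
    have : D / 2 * r ≤ ‖L.ι f‖ := by linarith
    rw [div_mul_eq_mul_div, le_div_iff₀ hD]
    linarith
  have := hrb α hα
  have h8 := om_pos hN ht α
  calc _ ≤ _ := this
    _ ≤ (2 / D * ‖L.ι f‖) * om N t α := by gcongr
    _ = _ := by ring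

end Ladder
end QRes


namespace QRes
namespace Ladder

section
variable {n : ℕ} {V H : Type} [AddCommGroup V] [Module ℂ V]
    [NormedAddCommGroup H] [InnerProductSpace ℂ H] (L : Ladder n V H)

theorem fac_add_le {N : ℕ} (α : Fin n → ℕ) (hα : ∑ j, α j ≤ N) (k) :
    √(fac (α + e k)) ≤ (N + 1) * √(fac α) := by
  have hk : (α k : ℝ) ≤ N := by
    have := Finset.single_le_sum (f := α) (fun _ _ => Nat.zero_le _) (Finset.mem_univ k)
    exact_mod_cast this.trans hα
  rw [fac_add]
  push_cast
  rw [Real.sqrt_mul (by positivity)]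
  gcongr
  rw [Real.sqrt_le_iff]
  have : (0:ℝ) ≤ N := Nat.cast_nonneg _
  exact ⟨by positivity, by nlinarith⟩

theorem fac_sub_le (α : Fin n → ℕ) (k) (hk : α k ≠ 0) :
    √(fac (α - e k)) ≤ √(fac α) := by
  apply Real.sqrt_le_sqrt
  have h := fac_add (α - e k) k
  rw [sub_add_e hk] at h
  rw [h]
  exact_mod_cast Nat.le_mul_of_pos_left _ (Nat.succ_pos _)

theorem norm_Qpsi {N : ℕ} (κ w : ℂ) (M S : Fin n → Fin n → ℂ) (α : Fin n → ℕ)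
    (hα : ∑ j, α j ≤ N) :
    ‖L.ι (L.Qop κ M S (L.psi α) - w • L.psi α)‖
      ≤ √(fac α) * (‖κ‖ + ‖w‖ + csum M S * (N + 2) ^ 2) := by
  have hN0 : (0:ℝ) ≤ N := Nat.cast_nonneg _
  have h1 : ∀ j k, ‖L.ι (L.bs j (L.bs k (L.psi α)))‖ ≤ (N + 2) ^ 2 * √(fac α) := by
    intro j k
    rw [← psi_add, ← psi_add, norm_psi]
    have h1 := fac_add_le α hα k
    have h2 := fac_add_le (N := N + 1) (α + e k) (by rw [sum_add_e]; omega) j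
    push_cast at h2
    calc _ ≤ _ := h2
      _ ≤ (N + 1 + 1) * ((N + 1) * √(fac α)) := by gcongr
      _ = ((N + 2) * (N + 1)) * √(fac α) := by ring
      _ ≤ _ := by
        gcongr
        nlinarith
  have h2 : ∀ j k, ‖L.ι (L.bs j (L.b k (L.psi α)))‖ ≤ (N + 2) ^ 2 * √(fac α) := by
    intro j k
    rw [b_psi]
    by_cases hk : α k = 0
    · simp [hk]; positivity
    rw [map_smul, ← psi_add, map_smul, norm_smul, norm_psi, Complex.norm_natCast]
    have hs := sum_add_e (α - e k) k
    rw [sub_add_e hk] at hs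
    have h1 := fac_add_le (N := N) (α - e k) (by omega) j
    have h3 := fac_sub_le α k hk
    have hkN : (α k : ℝ) ≤ N := by
      have := Finset.single_le_sum (f := α) (fun _ _ => Nat.zero_le _) (Finset.mem_univ k)
      exact_mod_cast this.trans hα
    calc _ ≤ N * ((N + 1) * √(fac α)) := by
          gcongr
          exact h1.trans (by gcongr)
      _ = (N * (N + 1)) * √(fac α) := by ring
      _ ≤ _ := by
        gcongr
        nlinarith
  have h3 : L.ι (L.Qop κ M S (L.psi α) - w • L.psi α) = (κ - w) • L.ι (L.psi α)
      + ∑ j, ∑ k, (M j k • L.ι (L.bs j (L.b k (L.psi α))) + S j k • L.ι (L.bs j (L.bs k (L.psi α)))) := by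
    simp only [Qop, map_sub, map_add, map_sum, map_smul, Finset.sum_add_distrib, sub_smul]
    abel
  rw [h3]
  calc _ ≤ (‖κ‖ + ‖w‖) * √(fac α) + ∑ j, ∑ k, (‖M j k‖ + ‖S j k‖) * ((N + 2) ^ 2 * √(fac α)) := by
        refine (norm_add_le _ _).trans (add_le_add ?_ ?_)
        · rw [norm_smul, norm_psi]
          gcongr
          exact norm_sub_le _ _
        · refine norm_sum_le_of_le _ fun j _ => norm_sum_le_of_le _ fun k _ => ?_
          refine (norm_add_le _ _).trans ?_
          rw [norm_smul, norm_smul, add_mul]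
          gcongr
          · exact h2 j k
          · exact h1 j k
    _ = _ := by
        unfold csum
        simp only [Finset.sum_mul, Finset.mul_sum, mul_add, add_mul]
        refine congrArg₂ (· + ·) (by ring) ?_
        refine Finset.sum_congr rfl fun j _ => Finset.sum_congr rfl fun k _ => ?_
        ring

theorem est_aux [CompleteSpace H] {N : ℕ} {t : ℝ} (hN : 1 ≤ N) (ht : 1 ≤ t) (κ w : ℂ) (M S : Fin n → Fin n → ℂ)
    (hM : ∀ j k, k < j → M j k = 0) (D : ℝ) (hD : 0 < D)
    (hw : ∀ α : Fin n → ℕ, D ≤ ‖κ + ∑ j, M j j * α j - w‖)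
    (hC : csum M S * N / t ≤ D / 2) (c₀ : ℝ) (hc₀ : 0 < c₀)
    (hcoer : ∀ u, c₀ * ∑ j, ‖L.ι (L.b j u)‖ ^ 2 ≤ (inner ℂ (L.ι u) (L.ι (L.Qop κ M S u))).re)
    (hbig : ‖w‖ + 1 ≤ c₀ * (N + 1)) (u : V) :
    ‖L.ι u‖ ≤ (1 + (N + 1) ^ n * (Real.exp (n * N) * t ^ (n * N)) * (2 / D)
      * (1 + (‖κ‖ + ‖w‖ + csum M S * (N + 2) ^ 2))) * ‖L.ι (L.Qop κ M S u - w • u)‖ := by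
  have ht0 : 0 < t := by linarith
  have hcs : 0 ≤ csum M S := by unfold csum; positivity
  set f := L.Qop κ M S u - w • u with hf
  set E := Real.exp (n * N) * t ^ (n * N) with hE
  have hE0 : 0 ≤ E := by positivity
  set G := ‖κ‖ + ‖w‖ + csum M S * (N + 2) ^ 2 with hG
  have hG0 : 0 ≤ G := by positivity
  set m := 2 / D * ‖L.ι f‖ with hm
  have hm0 : 0 ≤ m := by positivity
  set a : (Fin n → ℕ) → ℂ := fun α => L.d α u / fac α with ha
  set u1 := ∑ α ∈ low n N, a α • L.psi α with hu1
  have hd : ∀ α, α ∈ low n N → ‖a α‖ * √(fac α) ≤ E * m := by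
    intro α hα
    have h1 := L.low_bound hN ht κ w M S hM D hD hw hC u α (mem_low.1 hα)
    have h2 := om_le hN ht α (mem_low.1 hα)
    have hp : (0:ℝ) < fac α := by exact_mod_cast fac_pos α
    have hq := Real.sqrt_pos.2 hp
    simp only [ha]
    rw [norm_div, Complex.norm_natCast]
    calc _ = ‖L.d α u‖ * (√(fac α) / fac α) := by ring
      _ ≤ (√(fac α) * E * m) * (√(fac α) / fac α) := by
          gcongr
          exact h1.trans (by gcongr)
      _ = E * m * (√(fac α) * √(fac α) / fac α) := by ring
      _ = E * m := by rw [Real.mul_self_sqrt hp.le, div_self hp.ne', mul_one]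
  have hcard : ((low n N).card : ℝ) ≤ (N + 1) ^ n := by exact_mod_cast card_low
  have hn1 : ‖L.ι u1‖ ≤ (N + 1) ^ n * (E * m) := by
    rw [hu1, map_sum]
    refine (norm_sum_le_of_le _ (f := fun α => L.ι (a α • L.psi α)) (n := fun _ => E * m) fun α hα => ?_).trans ?_
    · rw [map_smul, norm_smul, norm_psi]; exact hd α hα
    · rw [Finset.sum_const, nsmul_eq_mul]
      gcongr
  have hn2 : ‖L.ι (L.Qop κ M S u1 - w • u1)‖ ≤ (N + 1) ^ n * (E * m * G) := by
    have : L.Qop κ M S u1 - w • u1 = ∑ α ∈ low n N, a α • (L.Qop κ M S (L.psi α) - w • L.psi α) := by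
      rw [hu1, Qop_sum, Finset.smul_sum, ← Finset.sum_sub_distrib]
      refine Finset.sum_congr rfl fun α _ => ?_
      rw [Qop_smul, smul_sub, smul_comm]
    rw [this, map_sum]
    refine (norm_sum_le_of_le _ (n := fun _ => E * m * G) fun α hα => ?_).trans ?_
    · rw [map_smul, norm_smul]
      have := L.norm_Qpsi κ w M S α (mem_low.1 hα)
      calc _ ≤ ‖a α‖ * (√(fac α) * G) := by gcongr
        _ = ‖a α‖ * √(fac α) * G := by ring
        _ ≤ _ := mul_le_mul_of_nonneg_right (hd α hα) hG0
    · rw [Finset.sum_const, nsmul_eq_mul]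
      gcongr
  set u2 := u - u1 with hu2
  have hlow : ∀ β, ∑ i, β i ≤ N → L.d β u2 = 0 := by
    intro β hβ
    rw [hu2, d_sub, hu1, d_sum]
    simp only [d_smul, d_psi]
    simp only [mul_ite, mul_zero, Finset.sum_ite_eq, mem_low.2 hβ, if_true, ha]
    have hp : (fac β : ℂ) ≠ 0 := by exact_mod_cast (fac_pos β).ne'
    rw [div_mul_cancel₀ _ hp, sub_self]
  have hhigh := L.high_bound N u2 hlow
  have h2 : ‖L.ι u2‖ ≤ ‖L.ι (L.Qop κ M S u2 - w • u2)‖ := by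
    set f2 := L.Qop κ M S u2 - w • u2 with hf2
    have hQ : L.Qop κ M S u2 = f2 + w • u2 := by rw [hf2, sub_add_cancel]
    have h3 := hcoer u2
    rw [hQ, map_add, map_smul, inner_add_right, inner_smul_right, Complex.add_re] at h3
    have h4 : (inner ℂ (L.ι u2) (L.ι f2)).re ≤ ‖L.ι u2‖ * ‖L.ι f2‖ :=
      (Complex.re_le_norm _).trans (norm_inner_le_norm _ _)
    have h5 : (w * inner ℂ (L.ι u2) (L.ι u2)).re ≤ ‖w‖ * ‖L.ι u2‖ ^ 2 := by
      refine (Complex.re_le_norm _).trans ?_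
      rw [norm_mul]
      gcongr
      refine (norm_inner_le_norm _ _).trans ?_
      rw [sq]
    have h6 : c₀ * ((N + 1) * ‖L.ι u2‖ ^ 2) ≤ c₀ * ∑ j, ‖L.ι (L.b j u2)‖ ^ 2 := by gcongr
    have h7 : (‖w‖ + 1) * ‖L.ι u2‖ ^ 2 ≤ c₀ * (N + 1) * ‖L.ι u2‖ ^ 2 := by gcongr
    have h8 : ‖L.ι u2‖ * ‖L.ι u2‖ ≤ ‖L.ι u2‖ * ‖L.ι f2‖ := by nlinarith
    by_cases h0 : ‖L.ι u2‖ = 0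
    · rw [h0]; positivity
    · exact le_of_mul_le_mul_left h8 (lt_of_le_of_ne (norm_nonneg _) (Ne.symm h0))
  have h3 : ‖L.ι (L.Qop κ M S u2 - w • u2)‖ ≤ ‖L.ι f‖ + ‖L.ι (L.Qop κ M S u1 - w • u1)‖ := by
    have : L.Qop κ M S u2 - w • u2 = f - (L.Qop κ M S u1 - w • u1) := by
      rw [hu2, Qop_sub, hf, smul_sub]; abel
    rw [this, map_sub]
    exact norm_sub_le _ _
  have h4 : ‖L.ι u‖ ≤ ‖L.ι u1‖ + ‖L.ι u2‖ := by
    have : u = u1 + u2 := by rw [hu2]; abel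
    conv_lhs => rw [this, map_add]
    exact norm_add_le _ _
  calc ‖L.ι u‖ ≤ (N + 1) ^ n * (E * m) + (‖L.ι f‖ + (N + 1) ^ n * (E * m * G)) := by linarith
    _ = _ := by rw [hm]; ring

end

set_option maxHeartbeats 1000000 in
theorem abstract_est (n : ℕ) (κ : ℂ) (M S : Fin n → Fin n → ℂ) (hM : ∀ j k, k < j → M j k = 0)
    (c₀ : ℝ) (hc₀ : 0 < c₀) (R : ℝ) (hR : 0 ≤ R) (δ : ℝ) (hδ : 0 < δ) :
    ∃ A' > 0, ∀ h : ℝ, 0 < h → h ≤ 1 → ∀ (V H : Type) [AddCommGroup V] [Module ℂ V]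
    [NormedAddCommGroup H] [InnerProductSpace ℂ H] [CompleteSpace H] (L : Ladder n V H),
    (∀ u, c₀ * ∑ j, ‖L.ι (L.b j u)‖ ^ 2 ≤ (inner ℂ (L.ι u) (L.ι (L.Qop κ M S u))).re) →
    ∀ w : ℂ, ‖w‖ ≤ R / h → (∀ α : Fin n → ℕ, δ / h ≤ ‖κ + ∑ j, M j j * α j - w‖) →
    ∀ u : V, ‖L.ι u‖ ≤ A' * Real.exp (A' / h) * ‖L.ι (L.Qop κ M S u - w • u)‖ := by
  have hcs : 0 ≤ csum M S := by unfold csum; positivity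
  set K : ℝ := (R + 1) / c₀ + 1 with hK
  have hK0 : 0 < K := by positivity
  set t : ℝ := max 1 (2 * csum M S * K / δ) with htd
  have ht : 1 ≤ t := le_max_left _ _
  have ht2 : 2 * csum M S * K / δ ≤ t := le_max_right _ _
  have ht0 : 0 < t := by linarith
  have hlt : 0 ≤ Real.log t := Real.log_nonneg ht
  set a : ℝ := 1 + (2 / δ) * (1 + ‖κ‖ + R + csum M S) with ha
  have ha0 : 0 < a := by positivity
  set B : ℝ := n * K + n * K * (1 + Real.log t) + (1 + 4 * K) with hB
  have hB0 : 0 < B := by positivity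
  refine ⟨a + B, by positivity, ?_⟩
  intro h hh hh1 V H _ _ _ _ _ L hcoer w hw hspec u
  set y : ℝ := 1 / h with hy
  have hy1 : 1 ≤ y := by rw [hy, le_div_iff₀ hh]; linarith
  set N := ⌈(R + 1) / c₀ * y⌉₊ with hNd
  have hpos : 0 < (R + 1) / c₀ * y := by positivity
  have hN : 1 ≤ N := Nat.one_le_iff_ne_zero.2 (Nat.ceil_pos.2 hpos).ne'
  have hN1 : (1:ℝ) ≤ N := by exact_mod_cast hN
  have hNle : (R + 1) / c₀ * y ≤ N := Nat.le_ceil _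
  have hNK : (N : ℝ) ≤ K * y := by
    have := (Nat.ceil_lt_add_one hpos.le).le
    calc (N : ℝ) ≤ (R + 1) / c₀ * y + 1 := this
      _ ≤ _ := by rw [hK, add_mul]; linarith
  have hwy : ‖w‖ ≤ R * y := by rw [hy, mul_one_div]; exact hw
  have hbig : ‖w‖ + 1 ≤ c₀ * (N + 1) := by
    have h1 : c₀ * ((R + 1) / c₀ * y) ≤ c₀ * N := by gcongr
    have h2 : c₀ * ((R + 1) / c₀ * y) = (R + 1) * y := by field_simp
    nlinarith
  have hC : csum M S * N / t ≤ δ / h / 2 := by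
    rw [div_le_iff₀ ht0]
    calc csum M S * N ≤ csum M S * (K * y) := by gcongr
      _ = δ / h / 2 * (2 * csum M S * K / δ) := by rw [hy]; field_simp
      _ ≤ _ := by gcongr
  have main := L.est_aux hN ht κ w M S hM (δ / h) (by positivity) hspec hC c₀ hc₀ hcoer hbig u
  refine main.trans ?_
  gcongr
  -- numeric bound
  have b1 : ((N:ℝ) + 1) ^ n ≤ Real.exp (n * K * y) := by
    calc ((N:ℝ) + 1) ^ n ≤ (Real.exp N) ^ n := by gcongr; exact Real.add_one_le_exp _
      _ = Real.exp (n * N) := (Real.exp_nat_mul _ _).symm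
      _ ≤ _ := by rw [mul_assoc]; gcongr
  have b2 : Real.exp (n * N) * t ^ (n * N) ≤ Real.exp (n * K * (1 + Real.log t) * y) := by
    have : t ^ (n * N) = Real.exp (n * N * Real.log t) := by
      rw [← Real.rpow_natCast, Real.rpow_def_of_pos ht0]
      push_cast; ring_nf
    rw [this, ← Real.exp_add]
    apply Real.exp_le_exp.2
    calc (n * N + n * N * Real.log t : ℝ) = (n * (1 + Real.log t)) * N := by ring
      _ ≤ (n * (1 + Real.log t)) * (K * y) := by gcongr
      _ = _ := by ring
  have b3 : 2 / (δ / h) ≤ 2 / δ := by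
    rw [div_div_eq_mul_div]
    gcongr
    linarith
  have b4 : 1 + (‖κ‖ + ‖w‖ + csum M S * (N + 2) ^ 2) ≤ (1 + ‖κ‖ + R + csum M S) * Real.exp ((1 + 4 * K) * y) := by
    have c1 : 1 ≤ Real.exp ((1 + 4 * K) * y) := Real.one_le_exp (by positivity)
    have c2 : y ≤ Real.exp ((1 + 4 * K) * y) := by
      have := Real.add_one_le_exp ((1 + 4 * K) * y)
      nlinarith [mul_pos hK0 (by linarith : (0:ℝ) < y)]
    have c3 : ((N:ℝ) + 2) ^ 2 ≤ Real.exp ((1 + 4 * K) * y) := by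
      have : (N:ℝ) + 2 ≤ Real.exp (2 * N) := by
        have := Real.add_one_le_exp (2 * (N:ℝ))
        linarith
      calc ((N:ℝ) + 2) ^ 2 ≤ (Real.exp (2 * N)) ^ 2 := by gcongr
        _ = Real.exp (4 * N) := by rw [← Real.exp_nat_mul]; push_cast; ring_nf
        _ ≤ _ := by
          apply Real.exp_le_exp.2
          nlinarith
    have c4 : ‖κ‖ * 1 ≤ ‖κ‖ * Real.exp ((1 + 4 * K) * y) := by gcongr
    have c5 : R * y ≤ R * Real.exp ((1 + 4 * K) * y) := by gcongr
    have c6 : csum M S * (N + 2) ^ 2 ≤ csum M S * Real.exp ((1 + 4 * K) * y) := by gcongr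
    linarith
  have b5 : (1:ℝ) ≤ Real.exp (B * y) := Real.one_le_exp (by positivity)
  calc _ ≤ 1 + Real.exp (n * K * y) * Real.exp (n * K * (1 + Real.log t) * y) * (2 / δ)
        * ((1 + ‖κ‖ + R + csum M S) * Real.exp ((1 + 4 * K) * y)) := by
        refine add_le_add le_rfl (mul_le_mul (mul_le_mul (mul_le_mul b1 b2 ?_ ?_) b3 ?_ ?_) b4 ?_ ?_)
        all_goals positivity
    _ = 1 + (2 / δ) * (1 + ‖κ‖ + R + csum M S) * Real.exp (B * y) := by
        have hexp : Real.exp (B * y) = Real.exp (n * K * y) * Real.exp (n * K * (1 + Real.log t) * y)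
            * Real.exp ((1 + 4 * K) * y) := by
          rw [← Real.exp_add, ← Real.exp_add, hB]; congr 1; ring
        rw [hexp]; ring
    _ ≤ a * Real.exp (B * y) := by rw [ha]; nlinarith
    _ ≤ (a + B) * Real.exp ((a + B) * y) := by
        gcongr <;> linarith
    _ = _ := by rw [hy, mul_one_div]

end Ladder
end QRes


namespace QRes

/-- Abstract canonical commutation relations. -/
structure CCR (n : ℕ) (V H : Type) [AddCommGroup V] [Module ℂ V]
    [NormedAddCommGroup H] [InnerProductSpace ℂ H] where
  ι : V →ₗ[ℂ] H
  R : (Fin n ⊕ Fin n) → Module.End ℂ V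
  sym : ∀ a u v, inner ℂ (ι (R a u)) (ι v) = inner ℂ (ι u) (ι (R a v))
  xx : ∀ j k u, R (Sum.inl j) (R (Sum.inl k) u) = R (Sum.inl k) (R (Sum.inl j) u)
  pp : ∀ j k u, R (Sum.inr j) (R (Sum.inr k) u) = R (Sum.inr k) (R (Sum.inr j) u)
  xp : ∀ j k u, R (Sum.inl j) (R (Sum.inr k) u) = R (Sum.inr k) (R (Sum.inl j) u)
    + if j = k then Complex.I • u else 0

/-- coefficients of the symplectically dual linear form -/
def coef {n : ℕ} (Y : (Fin n ⊕ Fin n) → ℂ) : (Fin n ⊕ Fin n) → ℂ :=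
  Sum.elim (fun j => Y (Sum.inr j)) (fun j => - Y (Sum.inl j))

theorem coef_sum {n : ℕ} (X Y : (Fin n ⊕ Fin n) → ℂ) : ∑ a, coef X a * Y a = sympForm X Y := by
  simp [coef, sympForm, Fintype.sum_sum_type, sub_eq_add_neg]

theorem qPolar_eq {n : ℕ} (A B C : Matrix (Fin n) (Fin n) ℂ) (hAs : A.IsSymm) (hCs : C.IsSymm)
    (X Y : (Fin n ⊕ Fin n) → ℂ) :
    qPolar A B C X Y = ∑ a, ∑ b, Matrix.fromBlocks A B.transpose B C a b * X a * Y b := by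
  have hA : ∀ (D : Matrix (Fin n) (Fin n) ℂ), D.IsSymm → ∀ x y : Fin n → ℂ,
      ∑ j, ∑ k, D j k * x k * y j = ∑ j, ∑ k, D j k * x j * y k := by
    intro D hD x y
    rw [Finset.sum_comm]
    refine Finset.sum_congr rfl fun j _ => Finset.sum_congr rfl fun k _ => ?_
    rw [hD.apply]
  simp only [Fintype.sum_sum_type, Matrix.fromBlocks_apply₁₁, Matrix.fromBlocks_apply₁₂,
    Matrix.fromBlocks_apply₂₁, Matrix.fromBlocks_apply₂₂, Matrix.transpose_apply,
    Finset.sum_add_distrib, qPolar]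
  rw [hA A hAs, hA C hCs]
  have h1 : ∑ k, (∑ l, B k l * X (Sum.inl l)) * Y (Sum.inr k)
      = ∑ j, ∑ k, B k j * X (Sum.inl j) * Y (Sum.inr k) := by
    rw [Finset.sum_comm]
    simp only [Finset.sum_mul]
  have h2 : ∑ k, (∑ l, B k l * Y (Sum.inl l)) * X (Sum.inr k)
      = ∑ j, ∑ k, B j k * X (Sum.inr j) * Y (Sum.inl k) := by
    simp only [Finset.sum_mul]
    refine Finset.sum_congr rfl fun j _ => Finset.sum_congr rfl fun k _ => ?_
    ring
  rw [h1, h2]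
  ring

theorem qPolar_smul_smul {n : ℕ} (A B C : Matrix (Fin n) (Fin n) ℂ) (hAs : A.IsSymm)
    (hCs : C.IsSymm) (X Y : (Fin n ⊕ Fin n) → ℂ) (s t : ℂ) :
    qPolar A B C (s • X) (t • Y) = s * t * qPolar A B C X Y := by
  rw [qPolar_eq A B C hAs hCs, qPolar_eq A B C hAs hCs]
  simp only [Finset.mul_sum, Pi.smul_apply, smul_eq_mul]
  refine Finset.sum_congr rfl fun j _ => Finset.sum_congr rfl fun k _ => ?_
  ring

namespace CCR

variable {n : ℕ} {V H : Type} [AddCommGroup V] [Module ℂ V]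
    [NormedAddCommGroup H] [InnerProductSpace ℂ H] (K : CCR n V H)

/-- the linear form operator `σ(Y, R)` -/
noncomputable def ell (Y : (Fin n ⊕ Fin n) → ℂ) : Module.End ℂ V := ∑ a, coef Y a • K.R a

theorem ell_apply (Y) (u : V) : K.ell Y u = ∑ a, coef Y a • K.R a u := by
  simp [ell]

/-- commutator symbol -/
noncomputable def cm (a b : Fin n ⊕ Fin n) : ℂ :=
  match a, b with
  | Sum.inl j, Sum.inr k => if j = k then Complex.I else 0
  | Sum.inr j, Sum.inl k => if j = k then -Complex.I else 0
  | _, _ => 0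

theorem R_comm (a b) (u : V) : K.R a (K.R b u) = K.R b (K.R a u) + (cm a b) • u := by
  rcases a with j | j <;> rcases b with k | k
  · rw [K.xx]; simp [cm]
  · rw [K.xp]; simp only [cm]; split_ifs <;> simp
  · rw [K.xp]; simp only [cm]
    by_cases h : j = k
    · subst h; simp
    · rw [if_neg h, if_neg (Ne.symm h)]; simp
  · rw [K.pp]; simp [cm]

theorem ell_comm (X Y) (u : V) :
    K.ell X (K.ell Y u) = K.ell Y (K.ell X u) + (-Complex.I * sympForm X Y) • u := by
  have h1 : K.ell X (K.ell Y u) = ∑ a, ∑ b, (coef X a * coef Y b) • K.R a (K.R b u) := by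
    rw [ell_apply]
    refine Finset.sum_congr rfl fun a _ => ?_
    rw [ell_apply, map_sum, Finset.smul_sum]
    refine Finset.sum_congr rfl fun b _ => ?_
    rw [map_smul, smul_smul]
  have h2 : K.ell Y (K.ell X u) = ∑ a, ∑ b, (coef X a * coef Y b) • K.R b (K.R a u) := by
    rw [Finset.sum_comm, ell_apply]
    refine Finset.sum_congr rfl fun a _ => ?_
    rw [ell_apply, map_sum, Finset.smul_sum]
    refine Finset.sum_congr rfl fun b _ => ?_
    rw [map_smul, smul_smul, mul_comm]
  have h3 : -Complex.I * sympForm X Y = ∑ a, ∑ b, coef X a * coef Y b * cm a b := by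
    simp only [Fintype.sum_sum_type, cm, coef, Sum.elim_inl, Sum.elim_inr, mul_zero, mul_ite,
      Finset.sum_ite_eq, Finset.mem_univ, if_true, Finset.sum_const_zero, zero_add, add_zero,
      sympForm]
    rw [mul_sub, Finset.mul_sum, Finset.mul_sum, ← Finset.sum_sub_distrib, ← Finset.sum_add_distrib]
    refine Finset.sum_congr rfl fun j _ => ?_
    ring
  rw [h1, h2, h3, Finset.sum_smul, ← Finset.sum_add_distrib]
  refine Finset.sum_congr rfl fun a _ => ?_
  rw [Finset.sum_smul, ← Finset.sum_add_distrib]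
  refine Finset.sum_congr rfl fun b _ => ?_
  rw [K.R_comm a b, smul_add, smul_smul]

theorem ell_adj (Y) (u v : V) :
    inner ℂ (K.ι (K.ell Y u)) (K.ι v) = inner ℂ (K.ι u) (K.ι (K.ell (star Y) v)) := by
  simp only [ell_apply, map_sum, map_smul, sum_inner, inner_sum, inner_smul_left, inner_smul_right,
    K.sym]
  refine Finset.sum_congr rfl fun a _ => ?_
  rcases a with j | j <;> simp [coef]

/-- columns of the inverse change of frame -/
noncomputable def Uv (Y : Fin n → (Fin n ⊕ Fin n) → ℂ) (c : Fin n ⊕ Fin n) : (Fin n ⊕ Fin n) → ℂ :=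
  match c with
  | Sum.inl j => (-Complex.I) • Y j
  | Sum.inr j => Complex.I • star (Y j)

/-- rows of the change of frame -/
noncomputable def Wv (Y : Fin n → (Fin n ⊕ Fin n) → ℂ) (c : Fin n ⊕ Fin n) : (Fin n ⊕ Fin n) → ℂ :=
  match c with
  | Sum.inl j => star (Y j)
  | Sum.inr j => Y j

variable (Y : Fin n → (Fin n ⊕ Fin n) → ℂ)

theorem WU (hY0 : ∀ j k, sympForm (Y j) (Y k) = 0)
    (hY1 : ∀ j k, sympForm (star (Y j)) (Y k) = if j = k then Complex.I else 0)
    (c d) : sympForm (Wv Y c) (Uv Y d) = if c = d then 1 else 0 := by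
  rcases c with j | j <;> rcases d with k | k <;> simp only [Wv, Uv, sympForm_smul_right]
  · rw [hY1]; by_cases h : j = k <;> simp [h]
  · rw [← star_sympForm, hY0]; simp
  · rw [hY0]; simp
  · rw [sympForm_swap, hY1]
    by_cases h : j = k
    · simp [h]
    · simp [h, Ne.symm h]

theorem UW (hY0 : ∀ j k, sympForm (Y j) (Y k) = 0)
    (hY1 : ∀ j k, sympForm (star (Y j)) (Y k) = if j = k then Complex.I else 0)
    (a b) : ∑ c, Uv Y c a * coef (Wv Y c) b = if a = b then 1 else 0 := by
  have h : (Matrix.of fun c a => coef (Wv Y c) a) * (Matrix.of fun a c => Uv Y c a)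
      = (1 : Matrix (Fin n ⊕ Fin n) (Fin n ⊕ Fin n) ℂ) := by
    ext c d
    rw [Matrix.mul_apply, Matrix.one_apply, ← WU Y hY0 hY1]
    simp only [Matrix.of_apply]
    exact coef_sum _ _
  have h' := mul_eq_one_comm.1 h
  have := congrFun (congrFun h' a) b
  rw [Matrix.mul_apply, Matrix.one_apply] at this
  exact this

theorem R_eq (hY0 : ∀ j k, sympForm (Y j) (Y k) = 0)
    (hY1 : ∀ j k, sympForm (star (Y j)) (Y k) = if j = k then Complex.I else 0)
    (a) (u : V) : K.R a u = ∑ c, Uv Y c a • K.ell (Wv Y c) u := by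
  simp only [ell_apply, Finset.smul_sum, smul_smul]
  rw [Finset.sum_comm]
  simp only [← Finset.sum_smul, UW Y hY0 hY1]
  simp

/-- The quadratic operator. -/
noncomputable def Qq (A B C : Matrix (Fin n) (Fin n) ℂ) (u : V) : V :=
  ∑ a, ∑ b, Matrix.fromBlocks A B.transpose B C a b • K.R a (K.R b u)

theorem Qq_eq (hY0 : ∀ j k, sympForm (Y j) (Y k) = 0)
    (hY1 : ∀ j k, sympForm (star (Y j)) (Y k) = if j = k then Complex.I else 0)
    (A B C : Matrix (Fin n) (Fin n) ℂ) (hAs : A.IsSymm) (hCs : C.IsSymm) (u : V) :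
    K.Qq A B C u = ∑ c, ∑ d, qPolar A B C (Uv Y c) (Uv Y d) • K.ell (Wv Y c) (K.ell (Wv Y d) u) := by
  have h1 : ∀ a b, K.R a (K.R b u) = ∑ c, ∑ d, (Uv Y c a * Uv Y d b) • K.ell (Wv Y c) (K.ell (Wv Y d) u) := by
    intro a b
    rw [K.R_eq Y hY0 hY1 a]
    refine Finset.sum_congr rfl fun c _ => ?_
    rw [K.R_eq Y hY0 hY1 b, map_sum, Finset.smul_sum]
    refine Finset.sum_congr rfl fun d _ => ?_
    rw [map_smul, smul_smul]
  simp only [Qq, h1, Finset.smul_sum, smul_smul, qPolar_eq A B C hAs hCs, Finset.sum_smul]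
  have key : ∀ f : (Fin n ⊕ Fin n) → (Fin n ⊕ Fin n) → (Fin n ⊕ Fin n) → (Fin n ⊕ Fin n) → V,
      ∑ a, ∑ b, ∑ c, ∑ d, f a b c d = ∑ c, ∑ d, ∑ a, ∑ b, f a b c d := by
    intro f
    have e1 : ∀ a, ∑ b, ∑ c, ∑ d, f a b c d = ∑ c, ∑ d, ∑ b, f a b c d := by
      intro a
      rw [Finset.sum_comm]
      exact Finset.sum_congr rfl fun c _ => Finset.sum_comm
    simp only [e1]
    rw [Finset.sum_comm]
    exact Finset.sum_congr rfl fun c _ => Finset.sum_comm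
  rw [key]
  simp only [mul_assoc]

theorem Qq_normal (hY0 : ∀ j k, sympForm (Y j) (Y k) = 0)
    (hY1 : ∀ j k, sympForm (star (Y j)) (Y k) = if j = k then Complex.I else 0)
    (A B C : Matrix (Fin n) (Fin n) ℂ) (hAs : A.IsSymm) (hCs : C.IsSymm)
    (F : Matrix (Fin n ⊕ Fin n) (Fin n ⊕ Fin n) ℂ)
    (hF : ∀ X Y, sympForm X (F.mulVec Y) = qPolar A B C X Y)
    (T : Matrix (Fin n) (Fin n) ℂ) (hT : ∀ k, F.mulVec (Y k) = - ∑ l, T l k • Y l) (u : V) :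
    K.Qq A B C u = (-Complex.I * ∑ j, T j j) • u
      + ∑ j, ∑ k, (-2 * Complex.I * T j k) • K.ell (Y j) (K.ell (star (Y k)) u)
      + ∑ j, ∑ k, (- qPolar A B C (star (Y j)) (star (Y k))) • K.ell (Y j) (K.ell (Y k) u) := by
  have hs : ∀ X k, qPolar A B C X (Y k) = - ∑ l, T l k * sympForm X (Y l) := by
    intro X k
    rw [← hF, hT]
    change sympLin X _ = _
    rw [map_neg, map_sum]
    simp only [map_smul, smul_eq_mul]
    rfl
  have q1 : ∀ j k, qPolar A B C (Y j) (Y k) = 0 := by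
    intro j k; rw [hs]; simp [hY0]
  have q2 : ∀ j k, qPolar A B C (star (Y j)) (Y k) = -Complex.I * T j k := by
    intro j k; rw [hs]; simp [hY1]; ring
  rw [K.Qq_eq Y hY0 hY1 A B C hAs hCs]
  simp only [Fintype.sum_sum_type, Uv, Wv, qPolar_smul_smul A B C hAs hCs, q1, mul_zero, zero_smul,
    Finset.sum_const_zero, zero_add]
  have q3 : ∀ j k, qPolar A B C (Y j) (star (Y k)) = -Complex.I * T k j := by
    intro j k; rw [qPolar_symm A B C hAs hCs, q2]
  simp only [q2, q3, K.ell_comm (star _) (Y _), hY1]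
  have i1 : (-Complex.I * Complex.I) = 1 := by simp
  have i2 : (Complex.I * -Complex.I) = 1 := by simp
  have i3 : (Complex.I * Complex.I) = -1 := by simp
  simp only [i1, i2, i3, one_mul, smul_add, Finset.sum_add_distrib, neg_one_mul]
  have s1 : ∑ j, ∑ k, (-Complex.I * T k j) • ((-Complex.I * if j = k then Complex.I else 0) • u)
      = (-Complex.I * ∑ j, T j j) • u := by
    rw [Finset.mul_sum, Finset.sum_smul]
    refine Finset.sum_congr rfl fun j _ => ?_
    rw [Finset.sum_eq_single j]
    · simp
    · intro k _ hk; rw [if_neg (Ne.symm hk)]; simp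
    · simp
  rw [s1]
  have s2 : ∑ j, ∑ k, (-Complex.I * T k j) • (K.ell (Y k)) ((K.ell (star (Y j))) u)
      = ∑ j, ∑ k, (-Complex.I * T j k) • (K.ell (Y j)) ((K.ell (star (Y k))) u) := Finset.sum_comm
  rw [s2]
  have s3 : ∑ j, ∑ k, (-2 * Complex.I * T j k) • K.ell (Y j) (K.ell (star (Y k)) u)
      = ∑ j, ∑ k, (-Complex.I * T j k) • (K.ell (Y j)) ((K.ell (star (Y k))) u)
      + ∑ j, ∑ k, (-Complex.I * T j k) • (K.ell (Y j)) ((K.ell (star (Y k))) u) := by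
    simp only [← Finset.sum_add_distrib, ← add_smul]
    refine Finset.sum_congr rfl fun j _ => Finset.sum_congr rfl fun k _ => ?_
    congr 1; ring
  rw [s3]
  abel

end CCR

open Matrix ComplexOrder MatrixOrder in
theorem coer_aux {n : ℕ} (A B C : Matrix (Fin n) (Fin n) ℂ) (hAs : A.IsSymm) (hCs : C.IsSymm)
    (hpos : ∀ x ξ : Fin n → ℝ, ¬(x = 0 ∧ ξ = 0) →
      0 < (qForm A B C (fun j => (x j : ℂ)) (fun j => (ξ j : ℂ))).re) :
    ∃ D : Matrix (Fin n ⊕ Fin n) (Fin n ⊕ Fin n) ℂ, IsUnit D ∧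
      Dᴴ * D = (2:ℂ)⁻¹ • (fromBlocks A Bᵀ B C + (fromBlocks A Bᵀ B C)ᴴ) := by
  set Q := fromBlocks A Bᵀ B C with hQ
  set P : Matrix (Fin n ⊕ Fin n) (Fin n ⊕ Fin n) ℂ := (2:ℂ)⁻¹ • (Q + Qᴴ) with hP
  have hH : P.IsHermitian := by
    unfold Matrix.IsHermitian
    rw [hP, conjTranspose_smul, conjTranspose_add, conjTranspose_conjTranspose, add_comm]
    congr 1
    simp
  have hq : ∀ x, star x ⬝ᵥ (Q *ᵥ x) = qPolar A B C (star x) x := by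
    intro x
    rw [qPolar_eq A B C hAs hCs]
    simp only [dotProduct, mulVec, Finset.mul_sum]
    refine Finset.sum_congr rfl fun a _ => Finset.sum_congr rfl fun b _ => ?_
    ring
  have hpd : P.PosDef := by
    refine PosDef.of_dotProduct_mulVec_pos hH ?_
    intro x hx
    have h1 := qPolar_star_pos A B C hAs hCs hpos x hx
    have h2 : star x ⬝ᵥ (P *ᵥ x) = ((qPolar A B C (star x) x).re : ℂ) := by
      rw [hP, smul_mulVec, add_mulVec, dotProduct_smul, dotProduct_add, hq]
      have h3 : star x ⬝ᵥ (Qᴴ *ᵥ x) = star (qPolar A B C (star x) x) := by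
        rw [← hq, star_dotProduct, star_mulVec, conjTranspose_conjTranspose, dotProduct_mulVec]
      rw [h3]
      change _ * (_ + (starRingEnd ℂ) _) = _
      rw [Complex.add_conj]
      push_cast; ring
    rw [h2]
    exact_mod_cast h1
  obtain ⟨D, hD⟩ := CStarAlgebra.nonneg_iff_eq_star_mul_self.mp hpd.posSemidef.nonneg
  refine ⟨D, ?_, hD.symm⟩
  have h := hpd.isUnit
  rw [hD] at h
  rw [Matrix.isUnit_iff_isUnit_det] at h ⊢
  rw [Matrix.det_mul] at h
  exact isUnit_of_mul_isUnit_right h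

theorem coercive {n : ℕ} (A B C : Matrix (Fin n) (Fin n) ℂ) (hAs : A.IsSymm) (hCs : C.IsSymm)
    (hpos : ∀ x ξ : Fin n → ℝ, ¬(x = 0 ∧ ξ = 0) →
      0 < (qForm A B C (fun j => (x j : ℂ)) (fun j => (ξ j : ℂ))).re)
    (Y : Fin n → (Fin n ⊕ Fin n) → ℂ) :
    ∃ c₀ > 0, ∀ (V H : Type) [AddCommGroup V] [Module ℂ V]
    [NormedAddCommGroup H] [InnerProductSpace ℂ H] (K : CCR n V H) (u : V),
    c₀ * ∑ j, ‖K.ι (K.ell (Y j) u)‖ ^ 2 ≤ (inner ℂ (K.ι u) (K.ι (K.Qq A B C u))).re := by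
  obtain ⟨D, hDu, hD⟩ := coer_aux A B C hAs hCs hpos
  set Q := Matrix.fromBlocks A B.transpose B C with hQ
  have hDi : D⁻¹ * D = 1 := Matrix.nonsing_inv_mul _ ((Matrix.isUnit_iff_isUnit_det _).1 hDu)
  set g : Fin n → (Fin n ⊕ Fin n) → ℂ := fun j c => ∑ a, coef (Y j) a * D⁻¹ a c with hg
  set G : ℝ := 1 + ∑ j, ∑ c, ‖g j c‖ ^ 2 with hG
  have hG0 : 0 < G := by positivity
  refine ⟨1 / G, by positivity, ?_⟩
  intro V H _ _ _ _ K u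
  set v : (Fin n ⊕ Fin n) → H := fun a => K.ι (K.R a u) with hv
  set y : (Fin n ⊕ Fin n) → H := fun c => ∑ b, D c b • v b with hy
  have h1 : inner ℂ (K.ι u) (K.ι (K.Qq A B C u)) = ∑ a, ∑ b, Q a b * inner ℂ (v a) (v b) := by
    simp only [CCR.Qq, map_sum, map_smul, inner_sum, inner_smul_right]
    refine Finset.sum_congr rfl fun a _ => Finset.sum_congr rfl fun b _ => ?_
    rw [← K.sym a]
  have h2 : ((∑ c, ‖y c‖ ^ 2 : ℝ) : ℂ) = ∑ a, ∑ b, (2:ℂ)⁻¹ * (Q a b + star (Q b a)) * inner ℂ (v a) (v b) := by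
    have h3 : ∀ a b, (2:ℂ)⁻¹ * (Q a b + star (Q b a)) = ∑ c, star (D c a) * D c b := by
      intro a b
      have := congrFun (congrFun hD a) b
      rw [Matrix.mul_apply] at this
      simp only [Matrix.smul_apply, Matrix.add_apply, Matrix.conjTranspose_apply, smul_eq_mul] at this
      exact this.symm
    have h4 : ∀ c, ((‖y c‖ ^ 2 : ℝ) : ℂ) = ∑ a, ∑ b, star (D c a) * D c b * inner ℂ (v a) (v b) := by
      intro c
      have := inner_self_eq_norm_sq_to_K (𝕜 := ℂ) (y c)
      rw [Complex.ofReal_pow]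
      refine (Eq.trans this.symm ?_)
      simp only [hy]
      rw [sum_inner]
      refine Finset.sum_congr rfl fun a _ => ?_
      rw [inner_sum]
      refine Finset.sum_congr rfl fun b _ => ?_
      rw [inner_smul_left, inner_smul_right, ← mul_assoc]
      rfl
    rw [Complex.ofReal_sum]
    simp only [h3, h4, Finset.sum_mul]
    rw [Finset.sum_comm]
    exact Finset.sum_congr rfl fun a _ => Finset.sum_comm
  have h5 : (inner ℂ (K.ι u) (K.ι (K.Qq A B C u))).re = ∑ c, ‖y c‖ ^ 2 := by
    rw [h1]
    apply Complex.ofReal_injective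
    rw [h2]
    have h6 : star (∑ a, ∑ b, Q a b * inner ℂ (v a) (v b)) = ∑ a, ∑ b, star (Q b a) * inner ℂ (v a) (v b) := by
      rw [star_sum, Finset.sum_comm]
      refine Finset.sum_congr rfl fun a _ => ?_
      rw [star_sum]
      refine Finset.sum_congr rfl fun b _ => ?_
      rw [star_mul']
      congr 1
      exact inner_conj_symm _ _
    have h7 := Complex.add_conj (∑ a, ∑ b, Q a b * inner ℂ (v a) (v b))
    have h8 : (∑ a, ∑ b, Q a b * inner ℂ (v a) (v b)) + ∑ a, ∑ b, star (Q b a) * inner ℂ (v a) (v b)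
      = ((2 * (∑ a, ∑ b, Q a b * inner ℂ (v a) (v b)).re : ℝ) : ℂ) := by
      rw [← h7, ← h6]; rfl
    simp only [mul_assoc, add_mul, mul_add, Finset.sum_add_distrib]
    simp only [← Finset.mul_sum]
    rw [← mul_add, h8]
    push_cast; ring
  have h9 : ∀ j, K.ι (K.ell (Y j) u) = ∑ c, g j c • y c := by
    intro j
    have hvy : ∀ a, v a = ∑ c, D⁻¹ a c • y c := by
      intro a
      simp only [hy, Finset.smul_sum, smul_smul]
      rw [Finset.sum_comm]
      simp only [← Finset.sum_smul, ← Matrix.mul_apply, hDi, Matrix.one_apply]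
      simp
    rw [CCR.ell_apply, map_sum]
    simp only [map_smul]
    have : ∀ a, K.ι (K.R a u) = ∑ c, D⁻¹ a c • y c := hvy
    simp only [this, hg, Finset.smul_sum, Finset.sum_smul, smul_smul]
    exact Finset.sum_comm
  have h10 : ∀ j, ‖K.ι (K.ell (Y j) u)‖ ^ 2 ≤ (∑ c, ‖g j c‖ ^ 2) * ∑ c, ‖y c‖ ^ 2 := by
    intro j
    refine le_trans ?_ (Finset.sum_mul_sq_le_sq_mul_sq Finset.univ (fun c => ‖g j c‖) (fun c => ‖y c‖))
    gcongr
    rw [h9]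
    exact norm_sum_le_of_le _ fun c _ => (norm_smul _ _).le
  rw [h5]
  rw [div_mul_eq_mul_div, one_mul, div_le_iff₀ hG0]
  have hs : 0 ≤ ∑ c, ‖y c‖ ^ 2 := by positivity
  calc ∑ j, ‖K.ι (K.ell (Y j) u)‖ ^ 2 ≤ ∑ j, (∑ c, ‖g j c‖ ^ 2) * ∑ c, ‖y c‖ ^ 2 := Finset.sum_le_sum fun j _ => h10 j
    _ = (∑ j, ∑ c, ‖g j c‖ ^ 2) * ∑ c, ‖y c‖ ^ 2 := by rw [Finset.sum_mul]
    _ ≤ _ := by rw [hG]; nlinarith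

end QRes


namespace QRes

open MeasureTheory SchwartzMap LineDeriv

/-- The Schwartz space on `ℝⁿ` -/
abbrev Sch (n : ℕ) := SchwartzMap (EuclideanSpace ℝ (Fin n)) ℂ

/-- The Hilbert space -/
noncomputable abbrev L2 (n : ℕ) := Lp ℂ 2 (volume : Measure (EuclideanSpace ℝ (Fin n)))

/-- the scaled coordinate function -/
noncomputable def crd {n : ℕ} (r : ℝ) (j : Fin n) (x : EuclideanSpace ℝ (Fin n)) : ℂ :=
  ((x j / r : ℝ) : ℂ)

theorem crd_eq {n : ℕ} (r : ℝ) (j : Fin n) :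
    crd r j = fun x => (Complex.ofRealCLM ∘L (r⁻¹ • EuclideanSpace.proj j)) x := by
  funext x
  simp [crd, div_eq_inv_mul]

theorem crd_tg {n : ℕ} (r : ℝ) (j : Fin n) : (crd (n := n) r j).HasTemperateGrowth := by
  rw [crd_eq]
  exact ContinuousLinearMap.hasTemperateGrowth _

/-- position operators -/
noncomputable def Xop {n : ℕ} (r : ℝ) (j : Fin n) : Module.End ℂ (Sch n) :=
  (smulLeftCLM ℂ (crd (n := n) r j)).toLinearMap

theorem Xop_apply {n : ℕ} (r : ℝ) (j : Fin n) (u : Sch n) (x) : Xop r j u x = crd r j x * u x := by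
  change smulLeftCLM ℂ (crd (n := n) r j) u x = _
  rw [smulLeftCLM_apply_apply (crd_tg r j)]
  rfl

/-- momentum operators -/
noncomputable def Pop {n : ℕ} (r : ℝ) (j : Fin n) : Module.End ℂ (Sch n) :=
  (-Complex.I * r) • (lineDerivOpCLM ℂ (Sch n) (EuclideanSpace.single j (1:ℝ))).toLinearMap

theorem Pop_apply {n : ℕ} (r : ℝ) (j : Fin n) (u : Sch n) (x) :
    Pop r j u x = (-Complex.I * r) * fderiv ℝ u x (EuclideanSpace.single j 1) := rfl

theorem Pop_eq {n : ℕ} (r : ℝ) (j : Fin n) (u : Sch n) :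
    Pop r j u = (-Complex.I * r) • lineDerivOp (EuclideanSpace.single j (1:ℝ)) u := rfl

theorem fderiv_crd_mul {n : ℕ} (r : ℝ) (j : Fin n) (u : Sch n) (x v) :
    fderiv ℝ (fun y => crd r j y * u y) x v = crd r j x * fderiv ℝ u x v + ((v j / r : ℝ) : ℂ) * u x := by
  have h1 : HasFDerivAt (crd (n := n) r j) (Complex.ofRealCLM ∘L (r⁻¹ • EuclideanSpace.proj j)) x := by
    rw [crd_eq]; exact ContinuousLinearMap.hasFDerivAt _
  have h2 := h1.mul (u.hasFDerivAt x)
  have h3 : fderiv ℝ (fun y => crd r j y * u y) x = _ := h2.fderiv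
  rw [h3]
  simp [div_eq_inv_mul]
  ring

theorem second_symm {n : ℕ} (u : Sch n) (x v w : EuclideanSpace ℝ (Fin n)) :
    fderiv ℝ (fun y => fderiv ℝ u y v) x w = fderiv ℝ (fun y => fderiv ℝ u y w) x v := by
  have hd : DifferentiableAt ℝ (fderiv ℝ u) x :=
    ((u.smooth 2).fderiv_right (m := 1) (by norm_num)).differentiable (by norm_num) x
  have e : ∀ v w, fderiv ℝ (fun y => fderiv ℝ u y v) x w = fderiv ℝ (fderiv ℝ u) x w v := by
    intro v w
    rw [fderiv_clm_apply hd (differentiableAt_const v)]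
    simp
  rw [e, e]
  exact ((u.smooth 2).contDiffAt.isSymmSndFDerivAt (by simp)) w v

theorem conj_int {n : ℕ} (u v : Sch n) (m : EuclideanSpace ℝ (Fin n)) :
    ∫ x, star (u x) * fderiv ℝ v x m = - ∫ x, star (fderiv ℝ u x m) * v x := by
  exact integral_bilinear_lineDerivOp_right_eq_neg_left (μ := volume) u v
    ((ContinuousLinearMap.mul ℝ ℂ).comp (Complex.conjCLE : ℂ →L[ℝ] ℂ)) m

theorem inner_S {n : ℕ} (u v : Sch n) :
    inner ℂ (toLpCLM ℂ ℂ 2 volume u : L2 n) (toLpCLM ℂ ℂ 2 volume v : L2 n) = ∫ x, star (u x) * v x := by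
  rw [toLpCLM_apply, toLpCLM_apply]
  refine (inner_toL2_toL2_eq u v volume).trans ?_
  congr 1
  funext x
  rw [RCLike.inner_apply, mul_comm]
  rfl

/-- the concrete representation -/
noncomputable def conc (n : ℕ) (r : ℝ) (hr : r ≠ 0) : CCR n (Sch n) (L2 n) where
  ι := (toLpCLM ℂ ℂ 2 volume).toLinearMap
  R := Sum.elim (Xop r) (Pop r)
  sym := by
    rintro (j | j) u v
    · refine (inner_S _ _).trans ((inner_S _ _).trans ?_).symm
      congr 1
      funext x
      simp only [Sum.elim_inl]
      rw [Xop_apply, Xop_apply, star_mul']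
      have : star (crd r j x) = crd r j x := Complex.conj_ofReal _
      rw [this]; ring
    · refine (inner_S _ _).trans ((inner_S _ _).trans ?_).symm
      simp only [Sum.elim_inr, Pop_apply, star_mul']
      have h := conj_int u v (EuclideanSpace.single j 1)
      have e1 : ∀ x, star (u x) * (-Complex.I * r * fderiv ℝ v x (EuclideanSpace.single j 1))
        = (-Complex.I * r) * (star (u x) * fderiv ℝ v x (EuclideanSpace.single j 1)) := fun x => by ring
      have e2 : ∀ x, star (-Complex.I) * star (r:ℂ) * star (fderiv ℝ u x (EuclideanSpace.single j 1)) * v x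
        = (Complex.I * r) * (star (fderiv ℝ u x (EuclideanSpace.single j 1)) * v x) := fun x => by
          have : star (r:ℂ) = r := Complex.conj_ofReal _
          rw [this]
          simp
          ring
      simp only [e1, e2]
      rw [integral_const_mul, integral_const_mul, h]
      ring
  xx := by
    intro j k u
    ext x
    simp only [Sum.elim_inl, Xop_apply]
    ring
  pp := by
    intro j k u
    ext x
    simp only [Sum.elim_inr, Pop_eq, lineDerivOp_smul, SchwartzMap.smul_apply]
    congr 2
    exact second_symm u x _ _
  xp := by
    intro j k u
    have e : ⇑(Xop r j u) = fun y => crd r j y * u y := funext fun y => Xop_apply r j u y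
    ext x
    rw [SchwartzMap.add_apply]
    simp only [Sum.elim_inr, Sum.elim_inl]
    rw [Xop_apply, Pop_apply, Pop_apply, e, fderiv_crd_mul]
    by_cases hjk : j = k
    · subst hjk
      have : (r:ℂ) ≠ 0 := by exact_mod_cast hr
      simp
      field_simp
      ring
    · simp [hjk]
      ring

theorem conc_inl {n : ℕ} (r : ℝ) (hr : r ≠ 0) (j) (u : Sch n) (x) :
    (conc n r hr).R (Sum.inl j) u x = crd r j x * u x := Xop_apply r j u x

theorem conc_inr {n : ℕ} (r : ℝ) (hr : r ≠ 0) (j) (u : Sch n) (x) :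
    (conc n r hr).R (Sum.inr j) u x = (-Complex.I * r) * fderiv ℝ u x (EuclideanSpace.single j 1) :=
  Pop_apply r j u x

theorem sum_ev {n : ℕ} {ι : Type*} (s : Finset ι) (f : ι → Sch n) (x) :
    (∑ i ∈ s, f i) x = ∑ i ∈ s, f i x := by
  simp

theorem weyl_eq {n : ℕ} (A B C : Matrix (Fin n) (Fin n) ℂ) (h r : ℝ) (hr : 0 < r) (hh : r ^ 2 = h)
    (u : Sch n) (x) :
    weylQuant A B C h (fun y => u y) x = (h : ℂ) * (conc n r hr.ne').Qq A B C u x := by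
  have hrc : (r:ℂ) ≠ 0 := by exact_mod_cast hr.ne'
  have hhc : (h:ℂ) = (r:ℂ)^2 := by rw [← hh]; push_cast; rfl
  have e1 : ∀ j k, (h:ℂ) * (conc n r hr.ne').R (Sum.inl j) ((conc n r hr.ne').R (Sum.inl k) u) x
      = (x j : ℂ) * (x k : ℂ) * u x := by
    intro j k
    rw [conc_inl, conc_inl, hhc]
    simp only [crd]; push_cast; field_simp
  have e2 : ∀ j k, (h:ℂ) * (conc n r hr.ne').R (Sum.inl j) ((conc n r hr.ne').R (Sum.inr k) u) x
      = (h / Complex.I) * (x j : ℂ) * fderiv ℝ u x (EuclideanSpace.single k 1) := by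
    intro j k
    rw [conc_inl, conc_inr, hhc]
    simp only [crd]; push_cast
    rw [div_eq_mul_inv _ Complex.I, Complex.inv_I]
    field_simp
  have e3 : ∀ j k, (h:ℂ) * (conc n r hr.ne').R (Sum.inr j) ((conc n r hr.ne').R (Sum.inl k) u) x
      = (h / Complex.I) * (x k : ℂ) * fderiv ℝ u x (EuclideanSpace.single j 1)
        + (h / Complex.I) * (if j = k then u x else 0) := by
    intro j k
    have h1 := (conc n r hr.ne').xp k j u
    have h2 : (conc n r hr.ne').R (Sum.inr j) ((conc n r hr.ne').R (Sum.inl k) u) x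
      = (conc n r hr.ne').R (Sum.inl k) ((conc n r hr.ne').R (Sum.inr j) u) x
        - (if k = j then Complex.I * u x else 0) := by
      rw [h1, SchwartzMap.add_apply]
      split_ifs <;> simp
    rw [h2, mul_sub, e2, div_eq_mul_inv _ Complex.I, Complex.inv_I]
    by_cases hjk : j = k
    · subst hjk; simp; ring
    · simp [hjk, Ne.symm hjk]
  have e4 : ∀ j k, (h:ℂ) * (conc n r hr.ne').R (Sum.inr j) ((conc n r hr.ne').R (Sum.inr k) u) x
      = -(h:ℂ)^2 * fderiv ℝ (fun y => fderiv ℝ u y (EuclideanSpace.single k 1)) x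
          (EuclideanSpace.single j 1) := by
    intro j k
    have : (conc n r hr.ne').R (Sum.inr j) ((conc n r hr.ne').R (Sum.inr k) u) x
      = (-Complex.I * r) * ((-Complex.I * r) * fderiv ℝ (fun y => fderiv ℝ u y (EuclideanSpace.single k 1)) x
          (EuclideanSpace.single j 1)) := by
      change Pop r j (Pop r k u) x = _
      simp only [Pop_eq, lineDerivOp_smul, SchwartzMap.smul_apply]
      rfl
    rw [this, hhc]
    linear_combination (r:ℂ)^4 * fderiv ℝ (fun y => fderiv ℝ u y (EuclideanSpace.single k 1)) x
          (EuclideanSpace.single j 1) * Complex.I_sq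
  have E : (h : ℂ) * (conc n r hr.ne').Qq A B C u x
      = ∑ a, ∑ b, Matrix.fromBlocks A B.transpose B C a b * ((h:ℂ) * (conc n r hr.ne').R a ((conc n r hr.ne').R b u) x) := by
    rw [CCR.Qq, sum_ev, Finset.mul_sum]
    refine Finset.sum_congr rfl fun a _ => ?_
    rw [sum_ev, Finset.mul_sum]
    refine Finset.sum_congr rfl fun b _ => ?_
    rw [SchwartzMap.smul_apply, smul_eq_mul]
    ring
  rw [E]
  simp only [Fintype.sum_sum_type, Matrix.fromBlocks_apply₁₁, Matrix.fromBlocks_apply₁₂,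
    Matrix.fromBlocks_apply₂₁, Matrix.fromBlocks_apply₂₂, Matrix.transpose_apply,
    Finset.sum_add_distrib, e1, e2, e3, e4, mul_add]
  have t1 : ∑ j, ∑ k, B j k * (h / Complex.I * (if j = k then u x else 0))
     = ((h : ℂ) / Complex.I) * (∑ j, B j j) * u x := by
    rw [Finset.mul_sum, Finset.sum_mul]
    refine Finset.sum_congr rfl fun j _ => ?_
    rw [Finset.sum_eq_single j]
    · simp; ring
    · intro b _ hb; simp [hb.symm]
    · simp
  have t2 : ∑ j, ∑ k, B k j * (h / Complex.I * (x j:ℂ) * fderiv ℝ u x (EuclideanSpace.single k 1))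
     = (h / Complex.I) * ∑ k, (∑ l, B k l * (x l : ℂ)) * fderiv ℝ u x (EuclideanSpace.single k 1) := by
    rw [Finset.sum_comm, Finset.mul_sum]
    refine Finset.sum_congr rfl fun j _ => ?_
    rw [Finset.sum_mul, Finset.mul_sum]
    refine Finset.sum_congr rfl fun k _ => ?_
    ring
  have t3 : ∑ j, ∑ k, B j k * (h / Complex.I * (x k:ℂ) * fderiv ℝ u x (EuclideanSpace.single j 1))
     = (h / Complex.I) * ∑ k, (∑ l, B k l * (x l : ℂ)) * fderiv ℝ u x (EuclideanSpace.single k 1) := by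
    rw [Finset.sum_comm]; exact t2
  have t4 : ∑ j, ∑ k, A j k * ((x j : ℂ) * (x k : ℂ) * u x) = (∑ j, ∑ k, A j k * (x j : ℂ) * (x k : ℂ)) * u x := by
    simp only [Finset.sum_mul]
    refine Finset.sum_congr rfl fun j _ => Finset.sum_congr rfl fun k _ => ?_
    ring
  have t5 : ∑ j, ∑ k, C j k * (-(h:ℂ)^2 * fderiv ℝ (fun y => fderiv ℝ u y (EuclideanSpace.single k 1)) x
          (EuclideanSpace.single j 1)) = - ((h : ℂ) ^ 2 * ∑ j, ∑ k, C j k *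
        fderiv ℝ (fun y => fderiv ℝ u y (EuclideanSpace.single k 1)) x
          (EuclideanSpace.single j 1)) := by
    simp only [Finset.mul_sum, ← Finset.sum_neg_distrib]
    refine Finset.sum_congr rfl fun j _ => Finset.sum_congr rfl fun k _ => ?_
    ring
  rw [t1, t2, t3, t4, t5, weylQuant]
  change _ = _
  ring

theorem norm_S {n : ℕ} (u : Sch n) : ‖(toLpCLM ℂ ℂ 2 volume u : L2 n)‖ = l2Norm (fun x => u x) := by
  rw [toLpCLM_apply, norm_toLp' (by norm_num) (by norm_num), l2Norm, Real.sqrt_eq_rpow]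
  norm_num

end QRes


namespace QRes

open Matrix ComplexOrder in
/-- existence of the Gaussian matrix -/
theorem exists_gaussMat {n : ℕ} (Y : Fin n → (Fin n ⊕ Fin n) → ℂ)
    (hY0 : ∀ j k, sympForm (Y j) (Y k) = 0)
    (hY1 : ∀ j k, sympForm (star (Y j)) (Y k) = if j = k then Complex.I else 0) :
    ∃ G : Matrix (Fin n) (Fin n) ℂ, (∀ j k, G j k = G k j) ∧
      (∀ j k, star (Y j) (Sum.inr k) = Complex.I * ∑ l, star (Y j) (Sum.inl l) * G l k) ∧
      ∃ c > 0, ∀ x : EuclideanSpace ℝ (Fin n), c * ‖x‖ ^ 2 ≤ (∑ j, ∑ k, G j k * x j * x k).re := by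
  set U : Matrix (Fin n) (Fin n) ℂ := Matrix.of fun j k => star (Y j) (Sum.inl k) with hU
  set E : Matrix (Fin n) (Fin n) ℂ := Matrix.of fun j k => star (Y j) (Sum.inr k) with hE
  have h0 : E * Uᵀ = U * Eᵀ := by
    ext j k
    have h := congrArg star (hY0 j k)
    rw [star_zero] at h
    simp only [sympForm, star_sub, star_sum, star_mul'] at h
    simp only [Matrix.mul_apply, Matrix.transpose_apply, hU, hE, Matrix.of_apply, Pi.star_apply]
    exact sub_eq_zero.mp h
  have h1 : E * Uᴴ - U * Eᴴ = Complex.I • (1 : Matrix (Fin n) (Fin n) ℂ) := by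
    ext j k
    have h := hY1 j k
    simp only [sympForm] at h
    simp only [Matrix.sub_apply, Matrix.mul_apply, Matrix.conjTranspose_apply, hU, hE, Matrix.of_apply,
      Pi.star_apply, star_star, Matrix.smul_apply, Matrix.one_apply] at h ⊢
    rw [h]
    split_ifs <;> simp
  have hUu : IsUnit U := by
    rw [← Matrix.vecMul_injective_iff_isUnit]
    refine (injective_iff_map_eq_zero (Matrix.vecMulLinear U)).2 ?_
    intro v hv
    replace hv : v ᵥ* U = 0 := hv
    have h2 : v ᵥ* (E * Uᴴ - U * Eᴴ) ⬝ᵥ star v = Complex.I * (v ⬝ᵥ star v) := by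
      rw [h1, Matrix.vecMul_smul, Matrix.vecMul_one, smul_dotProduct, smul_eq_mul]
    have h3 : Uᴴ *ᵥ star v = 0 := by
      rw [← Matrix.star_vecMul, hv, star_zero]
    rw [Matrix.vecMul_sub, sub_dotProduct, ← Matrix.vecMul_vecMul, ← Matrix.vecMul_vecMul, hv,
      ← Matrix.dotProduct_mulVec, h3] at h2
    simp at h2
    exact h2
  have hdet : IsUnit U.det := (Matrix.isUnit_iff_isUnit_det _).1 hUu
  set G := (-Complex.I) • (U⁻¹ * E) with hG
  have hUG : Complex.I • (U * G) = E := by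
    rw [hG, Matrix.mul_smul, smul_smul, Matrix.mul_nonsing_inv_cancel_left _ _ hdet]
    simp
  have hGs : Gᵀ = G := by
    rw [hG, Matrix.transpose_smul, Matrix.transpose_mul, Matrix.transpose_nonsing_inv]
    congr 1
    have hdt : IsUnit Uᵀ.det := by rw [Matrix.det_transpose]; exact hdet
    calc Eᵀ * Uᵀ⁻¹ = U⁻¹ * (U * Eᵀ) * Uᵀ⁻¹ := by rw [Matrix.nonsing_inv_mul_cancel_left _ _ hdet]
      _ = U⁻¹ * (E * Uᵀ) * Uᵀ⁻¹ := by rw [h0]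
      _ = U⁻¹ * E := by rw [Matrix.mul_assoc, Matrix.mul_nonsing_inv_cancel_right _ _ hdt]
  clear_value G
  have hEj : ∀ j k, E j k = star (Y j) (Sum.inr k) := fun j k => by rw [hE]; rfl
  have hUj : ∀ j k, U j k = star (Y j) (Sum.inl k) := fun j k => by rw [hU]; rfl
  clear_value U E
  clear hG
  have h5 : U * (G + Gᴴ) * Uᴴ = 1 := by
    have : Complex.I • (U * (G + Gᴴ) * Uᴴ) = Complex.I • (1 : Matrix (Fin n) (Fin n) ℂ) := by
      rw [← h1, ← hUG, Matrix.conjTranspose_smul, Matrix.conjTranspose_mul]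
      simp only [Matrix.mul_add, Matrix.add_mul, Matrix.smul_mul, Matrix.mul_smul, smul_add]
      rw [sub_eq_add_neg]
      congr 1
      simp [Matrix.mul_assoc]
    exact smul_right_injective _ Complex.I_ne_zero this
  refine ⟨G, fun j k => ?_, fun j k => ?_, ?_⟩
  · exact congrFun (congrFun hGs k) j
  · have := congrFun (congrFun hUG j) k
    rw [Matrix.smul_apply, Matrix.mul_apply] at this
    simp only [hEj, hUj] at this
    exact this.symm
  set N : ℝ := 1 + ∑ k, ∑ j, ‖Uᴴ k j‖ ^ 2 with hN
  have hN0 : 0 < N := by positivity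
  refine ⟨1 / (2 * N), by positivity, ?_⟩
  intro x
  set xc : Fin n → ℂ := fun j => (x j : ℂ) with hxc
  set w : Fin n → ℂ := (Uᴴ)⁻¹ *ᵥ xc with hw
  have hdH : IsUnit Uᴴ.det := by rw [Matrix.det_conjTranspose]; exact hdet.star
  have hx : Uᴴ *ᵥ w = xc := by
    rw [hw, Matrix.mulVec_mulVec, Matrix.mul_nonsing_inv _ hdH, Matrix.one_mulVec]
  have hs : star xc = xc := by
    funext j; exact Complex.conj_ofReal _
  have h6 : xc ⬝ᵥ ((G + Gᴴ) *ᵥ xc) = star w ⬝ᵥ w := by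
    have : star xc = star w ᵥ* U := by rw [← hx, Matrix.star_mulVec, conjTranspose_conjTranspose]
    calc xc ⬝ᵥ ((G + Gᴴ) *ᵥ xc) = star xc ⬝ᵥ ((G + Gᴴ) *ᵥ xc) := by rw [hs]
      _ = (star w ᵥ* U) ⬝ᵥ ((G + Gᴴ) *ᵥ (Uᴴ *ᵥ w)) := by rw [this, hx]
      _ = star w ⬝ᵥ ((U * (G + Gᴴ) * Uᴴ) *ᵥ w) := by
        rw [← Matrix.dotProduct_mulVec, Matrix.mulVec_mulVec, Matrix.mulVec_mulVec, Matrix.mul_assoc]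
      _ = _ := by rw [h5, Matrix.one_mulVec]
  have h7 : xc ⬝ᵥ (G *ᵥ xc) = ∑ j, ∑ k, G j k * x j * x k := by
    simp only [dotProduct, mulVec, Finset.mul_sum]
    refine Finset.sum_congr rfl fun j _ => Finset.sum_congr rfl fun k _ => ?_
    simp only [hxc]; ring
  have h8 : xc ⬝ᵥ (Gᴴ *ᵥ xc) = star (xc ⬝ᵥ (G *ᵥ xc)) := by
    conv_rhs => rw [← Matrix.star_dotProduct_star, Matrix.star_mulVec, hs, ← Matrix.dotProduct_mulVec]
  have h9 : star w ⬝ᵥ w = ((∑ j, ‖w j‖ ^ 2 : ℝ) : ℂ) := by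
    simp only [dotProduct, Complex.ofReal_sum]
    refine Finset.sum_congr rfl fun j _ => ?_
    rw [Pi.star_apply, Complex.ofReal_pow]
    exact RCLike.conj_mul (w j)
  have h10 : 2 * (∑ j, ∑ k, G j k * x j * x k).re = ∑ j, ‖w j‖ ^ 2 := by
    rw [Matrix.add_mulVec, dotProduct_add, h8, h9, h7] at h6
    have := congrArg Complex.re h6
    rw [Complex.ofReal_re, Complex.add_re] at this
    rw [← this]
    change _ = _ + ((starRingEnd ℂ) _).re
    rw [Complex.conj_re]; ring
  have h11 : ‖x‖ ^ 2 ≤ N * ∑ j, ‖w j‖ ^ 2 := by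
    rw [EuclideanSpace.norm_sq_eq]
    have : ∀ k, ‖x k‖ ^ 2 ≤ (∑ j, ‖Uᴴ k j‖ ^ 2) * ∑ j, ‖w j‖ ^ 2 := by
      intro k
      refine le_trans ?_ (Finset.sum_mul_sq_le_sq_mul_sq Finset.univ (fun j => ‖Uᴴ k j‖) (fun j => ‖w j‖))
      gcongr
      have e : ‖x k‖ = ‖(Uᴴ *ᵥ w) k‖ := by rw [hx, hxc]; exact (Complex.norm_real _).symm
      rw [e, Matrix.mulVec, dotProduct]
      exact norm_sum_le_of_le _ fun c _ => (norm_mul _ _).le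
    have hs' : 0 ≤ ∑ j, ‖w j‖ ^ 2 := by positivity
    calc _ ≤ ∑ k, (∑ j, ‖Uᴴ k j‖ ^ 2) * ∑ j, ‖w j‖ ^ 2 := Finset.sum_le_sum fun k _ => this k
      _ = (∑ k, ∑ j, ‖Uᴴ k j‖ ^ 2) * ∑ j, ‖w j‖ ^ 2 := by rw [Finset.sum_mul]
      _ ≤ _ := mul_le_mul_of_nonneg_right (by rw [hN]; linarith) hs'
  rw [div_mul_eq_mul_div, one_mul, div_le_iff₀ (mul_pos two_pos hN0)]
  rw [← h10] at h11
  linarith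

end QRes


namespace QRes

open MeasureTheory SchwartzMap

theorem norm_iteratedFDeriv_cexp (i : ℕ) (w : ℂ) :
    ‖iteratedFDeriv ℝ i Complex.exp w‖ ≤ ‖Complex.exp w‖ := by
  induction i with
  | zero => simp
  | succ i ih =>
    rw [← norm_iteratedFDeriv_fderiv]
    have h1 : fderiv ℝ Complex.exp = (ContinuousLinearMap.lsmul ℝ ℂ : ℂ →L[ℝ] ℂ →L[ℝ] ℂ) ∘ Complex.exp := by
      funext z
      have h := ((Complex.hasDerivAt_exp z).hasFDerivAt.restrictScalars ℝ).fderiv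
      rw [h]
      ext x
      simp [mul_comm]
    rw [h1]
    refine (ContinuousLinearMap.norm_iteratedFDeriv_comp_left _ (N := i)
      (Complex.contDiff_exp (𝕜 := ℝ)).contDiffAt le_rfl).trans ?_
    have h2 : ‖(ContinuousLinearMap.lsmul ℝ ℂ : ℂ →L[ℝ] ℂ →L[ℝ] ℂ)‖ ≤ 1 :=
      ContinuousLinearMap.opNorm_lsmul_le
    calc _ ≤ 1 * ‖Complex.exp w‖ := mul_le_mul h2 ih (norm_nonneg _) zero_le_one
      _ = _ := one_mul _

theorem poly_gauss_bound (c : ℝ) (hc : 0 < c) (m : ℕ) (t : ℝ) (ht : 0 ≤ t) :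
    (1 + t) ^ m * Real.exp (-c * t ^ 2) ≤ Real.exp (m ^ 2 / (4 * c)) := by
  have h1 : (1 + t) ^ m ≤ Real.exp (m * t) := by
    rw [Real.exp_nat_mul]
    gcongr
    rw [add_comm]; exact Real.add_one_le_exp t
  calc _ ≤ Real.exp (m * t) * Real.exp (-c * t ^ 2) := by gcongr
    _ = Real.exp (m * t + -c * t ^ 2) := (Real.exp_add _ _).symm
    _ ≤ _ := by
      apply Real.exp_le_exp.2
      rw [le_div_iff₀ (by positivity)]
      nlinarith [sq_nonneg ((m:ℝ) - 2 * c * t)]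

/-- Gaussian Schwartz functions -/
theorem exists_gauss {n : ℕ} (φ : EuclideanSpace ℝ (Fin n) → ℂ) (hφ : φ.HasTemperateGrowth)
    (c : ℝ) (hc : 0 < c) (hb : ∀ x, (φ x).re ≤ - c * ‖x‖ ^ 2) :
    ∃ g : Sch n, ∀ x, g x = Complex.exp (φ x) := by
  refine ⟨⟨fun x => Complex.exp (φ x), (Complex.contDiff_exp (𝕜 := ℝ)).comp hφ.1, ?_⟩, fun x => rfl⟩
  intro k m
  obtain ⟨l, C, hC0, hC⟩ := hφ.norm_iteratedFDeriv_le_uniform m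
  refine ⟨m.factorial * (1 + C) ^ m * Real.exp ((k + l * m : ℕ) ^ 2 / (4 * c)), fun x => ?_⟩
  have h1 : ‖iteratedFDeriv ℝ m (Complex.exp ∘ φ) x‖ ≤
      m.factorial * ‖Complex.exp (φ x)‖ * ((1 + C) * (1 + ‖x‖) ^ l) ^ m := by
    refine norm_iteratedFDeriv_comp_le (N := m) (Complex.contDiff_exp (𝕜 := ℝ))
      (hφ.1.of_le (by exact_mod_cast le_top)) le_rfl x (fun i _ => norm_iteratedFDeriv_cexp i _) ?_
    intro i hi him
    have hp : 1 ≤ (1 + ‖x‖) ^ l := one_le_pow₀ (by linarith [norm_nonneg x])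
    have hD : 1 ≤ (1 + C) * (1 + ‖x‖) ^ l := by nlinarith
    calc _ ≤ C * (1 + ‖x‖) ^ l := hC i him x
      _ ≤ (1 + C) * (1 + ‖x‖) ^ l := by gcongr; linarith
      _ ≤ _ := le_self_pow₀ hD (by omega)
  have h2 : ‖Complex.exp (φ x)‖ ≤ Real.exp (-c * ‖x‖ ^ 2) := by
    rw [Complex.norm_exp]; exact Real.exp_le_exp.2 (hb x)
  have h3 := poly_gauss_bound c hc (k + l * m) ‖x‖ (norm_nonneg x)
  calc ‖x‖ ^ k * ‖iteratedFDeriv ℝ m (Complex.exp ∘ φ) x‖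
      ≤ (1 + ‖x‖) ^ k * (m.factorial * Real.exp (-c * ‖x‖ ^ 2) * ((1 + C) * (1 + ‖x‖) ^ l) ^ m) := by
        have h4 : ‖x‖ ^ k ≤ (1 + ‖x‖) ^ k := by gcongr; linarith
        refine mul_le_mul h4 (h1.trans ?_) (norm_nonneg _) (by positivity)
        gcongr
    _ = m.factorial * (1 + C) ^ m * ((1 + ‖x‖) ^ (k + l * m) * Real.exp (-c * ‖x‖ ^ 2)) := by
        rw [mul_pow, ← pow_mul, pow_add]; ring
    _ ≤ _ := by gcongr

/-- the quadratic exponent -/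
noncomputable def qexp {n : ℕ} (G : Matrix (Fin n) (Fin n) ℂ) (r : ℝ) (x : EuclideanSpace ℝ (Fin n)) : ℂ :=
  ∑ j, ∑ k, (-(1/2) * G j k) * (crd r j x * crd r k x)

theorem qexp_tg {n : ℕ} (G : Matrix (Fin n) (Fin n) ℂ) (r : ℝ) : (qexp G r).HasTemperateGrowth := by
  unfold qexp
  refine Function.HasTemperateGrowth.sum fun j _ => Function.HasTemperateGrowth.sum fun k _ => ?_
  exact (Function.HasTemperateGrowth.const _).mul ((crd_tg r j).mul (crd_tg r k))

theorem qexp_eq {n : ℕ} (G : Matrix (Fin n) (Fin n) ℂ) (r : ℝ) (x : EuclideanSpace ℝ (Fin n)) :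
    qexp G r x = ((-(1 / (2 * r ^ 2)) : ℝ) : ℂ) * ∑ j, ∑ k, G j k * x j * x k := by
  simp only [qexp, Finset.mul_sum, crd]
  refine Finset.sum_congr rfl fun j _ => Finset.sum_congr rfl fun k _ => ?_
  by_cases hr : (r:ℂ) = 0
  · simp [hr]
  push_cast
  field_simp

theorem qexp_re {n : ℕ} (G : Matrix (Fin n) (Fin n) ℂ) (r : ℝ) (hr : 0 < r) (c : ℝ)
    (hG : ∀ x : EuclideanSpace ℝ (Fin n), c * ‖x‖ ^ 2 ≤ (∑ j, ∑ k, G j k * x j * x k).re)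
    (x : EuclideanSpace ℝ (Fin n)) : (qexp G r x).re ≤ -(c / (2 * r ^ 2)) * ‖x‖ ^ 2 := by
  rw [qexp_eq, Complex.re_ofReal_mul]
  have := mul_le_mul_of_nonneg_left (hG x) (show 0 ≤ 1 / (2 * r ^ 2) by positivity)
  calc _ ≤ -(1 / (2 * r ^ 2) * (c * ‖x‖ ^ 2)) := by linarith
    _ = _ := by ring

theorem hasFDerivAt_crd {n : ℕ} (r : ℝ) (j : Fin n) (x) :
    HasFDerivAt (crd (n := n) r j) (Complex.ofRealCLM ∘L (r⁻¹ • EuclideanSpace.proj j)) x := by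
  rw [crd_eq]; exact ContinuousLinearMap.hasFDerivAt _

theorem fderiv_qexp {n : ℕ} (G : Matrix (Fin n) (Fin n) ℂ) (hG : ∀ j k, G j k = G k j) (r : ℝ) (x) (l : Fin n) :
    fderiv ℝ (qexp G r) x (EuclideanSpace.single l 1) = -(r:ℂ)⁻¹ * ∑ k, G l k * crd r k x := by
  have h := HasFDerivAt.fun_sum (u := Finset.univ) fun j _ => HasFDerivAt.fun_sum (u := Finset.univ) fun k _ =>
    (((hasFDerivAt_crd r j x).mul (hasFDerivAt_crd r k x)).const_mul (-(1/2) * G j k))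
  have h' : fderiv ℝ (qexp G r) x = _ := h.fderiv
  have e0 : ∀ k, ((r⁻¹ * (EuclideanSpace.single l (1:ℝ) : EuclideanSpace ℝ (Fin n)) k : ℝ) : ℂ)
      = if k = l then (r:ℂ)⁻¹ else 0 := by
    intro k
    rw [PiLp.single_apply]
    split_ifs <;> simp
  have e : fderiv ℝ (qexp G r) x (EuclideanSpace.single l 1) = ∑ j, ∑ k,
      ((if k = l then -(1/2) * (r:ℂ)⁻¹ * (G j k * crd r j x) else 0)
        + (if j = l then -(1/2) * (r:ℂ)⁻¹ * (G j k * crd r k x) else 0)) := by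
    rw [h', sum_apply]
    refine Finset.sum_congr rfl fun j _ => ?_
    rw [sum_apply]
    refine Finset.sum_congr rfl fun k _ => ?_
    change (-(1/2) * G j k) * (crd r j x *
      ((r⁻¹ * (EuclideanSpace.single l (1:ℝ) : EuclideanSpace ℝ (Fin n)) k : ℝ) : ℂ)
      + crd r k x * ((r⁻¹ * (EuclideanSpace.single l (1:ℝ) : EuclideanSpace ℝ (Fin n)) j : ℝ) : ℂ)) = _
    rw [e0, e0]
    split_ifs <;> ring
  rw [e]
  simp only [Finset.sum_add_distrib]
  have s1 : ∑ j, ∑ k, (if k = l then -(1/2) * (r:ℂ)⁻¹ * (G j k * crd r j x) else 0)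
     = -(1/2) * (r:ℂ)⁻¹ * ∑ k, G l k * crd r k x := by
    rw [Finset.mul_sum]
    refine Finset.sum_congr rfl fun j _ => ?_
    rw [Finset.sum_ite_eq' Finset.univ l, if_pos (Finset.mem_univ _), hG j l]
  have s2 : ∑ j, ∑ k, (if j = l then -(1/2) * (r:ℂ)⁻¹ * (G j k * crd r k x) else 0)
     = -(1/2) * (r:ℂ)⁻¹ * ∑ k, G l k * crd r k x := by
    rw [Finset.mul_sum, Finset.sum_comm]
    refine Finset.sum_congr rfl fun j _ => ?_
    rw [Finset.sum_ite_eq' Finset.univ l, if_pos (Finset.mem_univ _)]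
  rw [s1, s2]
  ring

theorem gauss_kill {n : ℕ} (G : Matrix (Fin n) (Fin n) ℂ) (hG : ∀ j k, G j k = G k j) (r : ℝ) (hr : 0 < r)
    (g : Sch n) (hg : ∀ x, g x = Complex.exp (qexp G r x)) (Z : (Fin n ⊕ Fin n) → ℂ)
    (hZ : ∀ k, Z (Sum.inr k) = Complex.I * ∑ l, Z (Sum.inl l) * G l k) :
    (conc n r hr.ne').ell Z g = 0 := by
  have hrc : (r:ℂ) ≠ 0 := by exact_mod_cast hr.ne'
  ext x
  have hd : ∀ l, fderiv ℝ g x (EuclideanSpace.single l 1) = -(r:ℂ)⁻¹ * (∑ k, G l k * crd r k x) * g x := by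
    intro l
    have e : ⇑g = fun x => Complex.exp (qexp G r x) := funext hg
    have hq : HasFDerivAt (qexp G r) (fderiv ℝ (qexp G r) x) x :=
      ((qexp_tg G r).1.differentiable (by simp) x).hasFDerivAt
    have h := hq.cexp.fderiv
    rw [e, h]
    simp only [ContinuousLinearMap.smul_apply, smul_eq_mul, fderiv_qexp G hG]
    ring
  rw [CCR.ell_apply, sum_ev, Fintype.sum_sum_type]
  have e1 : ∀ j, (coef Z (Sum.inl j) • (conc n r hr.ne').R (Sum.inl j) g) x = Z (Sum.inr j) * (crd r j x * g x) := by
    intro j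
    rw [SchwartzMap.smul_apply, conc_inl]; rfl
  have e2 : ∀ j, (coef Z (Sum.inr j) • (conc n r hr.ne').R (Sum.inr j) g) x
      = - (Complex.I * Z (Sum.inl j) * (∑ k, G j k * crd r k x) * g x) := by
    intro j
    rw [SchwartzMap.smul_apply, conc_inr, hd]
    simp only [coef, Sum.elim_inr, smul_eq_mul]
    field_simp
  simp only [e1, e2, hZ, Finset.sum_neg_distrib]
  rw [SchwartzMap.zero_apply, add_neg_eq_zero]
  simp only [Finset.mul_sum, Finset.sum_mul]
  rw [Finset.sum_comm]
  refine Finset.sum_congr rfl fun j _ => Finset.sum_congr rfl fun k _ => ?_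
  ring

end QRes


namespace QRes

open MeasureTheory SchwartzMap FourierTransform

/-- injectivity of the Fourier transform on `L¹` -/
theorem ae_zero_of_fourier {n : ℕ} (f : EuclideanSpace ℝ (Fin n) → ℂ) (hf : Integrable f)
    (h : ∀ ξ : EuclideanSpace ℝ (Fin n), ∫ x, Complex.exp (Complex.I * (inner ℝ x ξ : ℝ)) * f x = 0) :
    ∀ᵐ x, f x = 0 := by
  have hF : ∀ w, 𝓕 f w = 0 := by
    intro w
    rw [Real.fourier_eq']
    rw [← h ((-2 * Real.pi) • w)]
    congr 1
    funext x
    rw [smul_eq_mul, inner_smul_right, mul_comm Complex.I]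
  refine ae_eq_zero_of_integral_contDiff_smul_eq_zero hf.locallyIntegrable ?_
  intro φ hφ hφc
  have hφ' : ContDiff ℝ (⊤ : ℕ∞) (fun x => (φ x : ℂ)) := Complex.ofRealCLM.contDiff.comp hφ
  have hφc' : HasCompactSupport (fun x => (φ x : ℂ)) := hφc.comp_left (g := Complex.ofReal) Complex.ofReal_zero
  set ψ : Sch n := hφc'.toSchwartzMap hφ' with hψ
  have hψx : ∀ x, ψ x = (φ x : ℂ) := fun x => rfl
  have key := VectorFourier.integral_fourierIntegral_smul_eq_flip (L := innerₗ (EuclideanSpace ℝ (Fin n)))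
    (μ := volume) (ν := volume)
    Real.continuous_fourierChar continuous_inner hf (𝓕⁻ ψ : Sch n).integrable
  have e1 : ∀ x, VectorFourier.fourierIntegral Real.fourierChar volume
      (innerₗ (EuclideanSpace ℝ (Fin n))).flip (𝓕⁻ ψ : Sch n) x = ψ x := by
    intro x
    rw [flip_innerₗ]
    change 𝓕 (⇑(𝓕⁻ ψ : Sch n)) x = _
    rw [← SchwartzMap.fourier_coe, FourierTransform.fourier_fourierInv_eq]
  have e2 : ∀ x, VectorFourier.fourierIntegral Real.fourierChar volume
      (innerₗ (EuclideanSpace ℝ (Fin n))) f x = 0 := hF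
  simp only [e1, e2, zero_smul, integral_zero] at key
  rw [key]
  congr 1
  funext x
  rw [hψx, smul_eq_mul, Complex.real_smul, mul_comm]

/-- multiplication by a real linear function -/
noncomputable def Xlin {n : ℕ} (r : ℝ) (ξ : EuclideanSpace ℝ (Fin n)) : Module.End ℂ (Sch n) :=
  ∑ j, ((ξ j * r : ℝ) : ℂ) • Xop r j

theorem Xlin_apply {n : ℕ} (r : ℝ) (hr : 0 < r) (ξ : EuclideanSpace ℝ (Fin n)) (u : Sch n) (x) :
    Xlin r ξ u x = ((inner ℝ x ξ : ℝ) : ℂ) * u x := by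
  have hrc : (r:ℂ) ≠ 0 := by exact_mod_cast hr.ne'
  rw [Xlin, LinearMap.sum_apply, sum_ev, PiLp.inner_apply, Complex.ofReal_sum, Finset.sum_mul]
  refine Finset.sum_congr rfl fun j _ => ?_
  rw [LinearMap.smul_apply, SchwartzMap.smul_apply, Xop_apply, smul_eq_mul, crd]
  simp only [RCLike.inner_apply, conj_trivial]
  push_cast
  field_simp

theorem Xlin_pow_apply {n : ℕ} (r : ℝ) (hr : 0 < r) (ξ : EuclideanSpace ℝ (Fin n)) (k : ℕ) (u : Sch n) (x) :
    ((Xlin r ξ) ^ k) u x = ((inner ℝ x ξ : ℝ) : ℂ) ^ k * u x := by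
  induction k with
  | zero => simp
  | succ k ih =>
    rw [pow_succ', Module.End.mul_apply, Xlin_apply r hr, ih]; ring

theorem complete_gauss {n : ℕ} (r : ℝ) (hr : 0 < r) (g : Sch n) (hg0 : ∀ x, g x ≠ 0) (c : ℝ) (hc : 0 < c)
    (hgb : ∀ x, ‖g x‖ ≤ Real.exp (-c * ‖x‖ ^ 2)) (E : Submodule ℂ (Sch n)) (hgE : g ∈ E)
    (hE : ∀ j, ∀ u ∈ E, Xop r j u ∈ E) (v : L2 n)
    (hv : ∀ u ∈ E, inner ℂ (toLpCLM ℂ ℂ 2 volume u : L2 n) v = 0) : v = 0 := by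
  set f : EuclideanSpace ℝ (Fin n) → ℂ := fun x => star (g x) * v x with hf
  have hvm : MemLp v 2 volume := Lp.memLp v
  have hfm : AEStronglyMeasurable f volume :=
    g.continuous.star.aestronglyMeasurable.mul hvm.1
  -- auxiliary Gaussian
  obtain ⟨g2, hg2⟩ := exists_gauss (n := n) (fun x => ((-(c / 2) * ‖x‖ ^ 2 : ℝ) : ℂ))
    (by
      have h1 : (fun x : EuclideanSpace ℝ (Fin n) => ‖x‖ ^ 2).HasTemperateGrowth := Function.hasTemperateGrowth_norm_sq _
      have h2 : (fun x : EuclideanSpace ℝ (Fin n) => -(c / 2) * ‖x‖ ^ 2).HasTemperateGrowth :=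
        (Function.HasTemperateGrowth.const _).mul h1
      exact Function.Complex.hasTemperateGrowth_ofReal.comp h2) (c / 2) (by positivity)
    (fun x => by rw [Complex.ofReal_re])
  have hg2n : ∀ x, ‖g2 x‖ = Real.exp (-(c / 2) * ‖x‖ ^ 2) := by
    intro x; rw [hg2, Complex.norm_exp, Complex.ofReal_re]
  have hint2 : Integrable (fun x => ‖g2 x‖ * ‖v x‖) := by
    have := (MemLp.integrable_mul (p := 2) (q := 2) (g2.memLp 2 volume) hvm).norm
    simpa using this
  have hbd : ∀ ξ x : EuclideanSpace ℝ (Fin n), Real.exp |inner ℝ x ξ| * ‖f x‖ ≤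
      Real.exp (‖ξ‖ ^ 2 / (2 * c)) * (‖g2 x‖ * ‖v x‖) := by
    intro ξ x
    rw [hf]
    simp only [norm_mul, norm_star]
    rw [← mul_assoc, ← mul_assoc]
    refine mul_le_mul_of_nonneg_right ?_ (norm_nonneg _)
    rw [hg2n, ← Real.exp_add]
    refine (mul_le_mul_of_nonneg_left (hgb x) (Real.exp_nonneg _)).trans ?_
    rw [← Real.exp_add]
    apply Real.exp_le_exp.2
    have h1 : |inner ℝ x ξ| ≤ ‖x‖ * ‖ξ‖ := abs_real_inner_le_norm x ξ
    have h2 : ‖x‖ * ‖ξ‖ ≤ ‖ξ‖ ^ 2 / (2 * c) + (c / 2) * ‖x‖ ^ 2 := by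
      rw [← sub_nonneg]
      have : ‖ξ‖ ^ 2 / (2 * c) + (c / 2) * ‖x‖ ^ 2 - ‖x‖ * ‖ξ‖ = (‖ξ‖ - c * ‖x‖) ^ 2 / (2 * c) := by
        field_simp; ring
      rw [this]; positivity
    linarith
  have hexpf : ∀ ξ : EuclideanSpace ℝ (Fin n), Integrable (fun x => Real.exp |inner ℝ x ξ| * ‖f x‖) := by
    intro ξ
    refine Integrable.mono' (hint2.const_mul (Real.exp (‖ξ‖ ^ 2 / (2 * c)))) ?_ ?_
    · refine AEStronglyMeasurable.mul ?_ hfm.norm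
      have : Continuous fun x : EuclideanSpace ℝ (Fin n) => Real.exp |inner ℝ x ξ| := by fun_prop
      exact this.aestronglyMeasurable
    · refine Filter.Eventually.of_forall fun x => ?_
      rw [Real.norm_of_nonneg (by positivity)]
      exact hbd ξ x
  have hfi : Integrable f := by
    have := hexpf 0
    simp only [inner_zero_right, abs_zero, Real.exp_zero, one_mul] at this
    exact (integrable_norm_iff hfm).1 this
  have hXE : ∀ ξ : EuclideanSpace ℝ (Fin n), ∀ u ∈ E, Xlin r ξ u ∈ E := by
    intro ξ u hu
    rw [Xlin, LinearMap.sum_apply]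
    exact Submodule.sum_mem _ fun j _ => E.smul_mem _ (hE j u hu)
  have hpE : ∀ (ξ : EuclideanSpace ℝ (Fin n)) (k : ℕ), ((Xlin r ξ) ^ k) g ∈ E := by
    intro ξ k
    induction k with
    | zero => simpa using hgE
    | succ k ih => rw [pow_succ', Module.End.mul_apply]; exact hXE ξ _ ih
  have hmom : ∀ (ξ : EuclideanSpace ℝ (Fin n)) (k : ℕ), ∫ x, ((inner ℝ x ξ : ℝ) : ℂ) ^ k * f x = 0 := by
    intro ξ k
    rw [← hv _ (hpE ξ k), L2.inner_def]
    apply integral_congr_ae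
    have h1 := coeFn_toLp (((Xlin r ξ) ^ k) g) 2 volume
    filter_upwards [h1] with x hx
    rw [toLpCLM_apply, hx, Xlin_pow_apply r hr, RCLike.inner_apply]
    have : (starRingEnd ℂ) (((inner ℝ x ξ : ℝ) : ℂ) ^ k * g x) = ((inner ℝ x ξ : ℝ) : ℂ) ^ k * star (g x) := by
      rw [map_mul, map_pow, Complex.conj_ofReal]; rfl
    rw [this, hf]; ring
  have hzero : ∀ᵐ x, f x = 0 := by
    refine ae_zero_of_fourier f hfi ?_
    intro ξ
    have hsum : HasSum (fun k : ℕ => ∫ x, (Complex.I * (inner ℝ x ξ : ℝ)) ^ k / (k.factorial : ℂ) * f x)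
        (∫ x, Complex.exp (Complex.I * (inner ℝ x ξ : ℝ)) * f x) := by
      have hs : ∀ x, HasSum (fun k : ℕ => |inner ℝ x ξ| ^ k / (k.factorial : ℝ) * ‖f x‖)
          (Real.exp |inner ℝ x ξ| * ‖f x‖) := by
        intro x
        have := NormedSpace.expSeries_div_hasSum_exp (|inner ℝ x ξ| : ℝ)
        rw [← Real.exp_eq_exp_ℝ] at this
        exact this.mul_right _
      refine hasSum_integral_of_dominated_convergence
        (fun k x => |inner ℝ x ξ| ^ k / (k.factorial : ℝ) * ‖f x‖) ?_ ?_ ?_ ?_ ?_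
      · intro k
        refine AEStronglyMeasurable.mul ?_ hfm
        have : Continuous fun x : EuclideanSpace ℝ (Fin n) =>
          (Complex.I * (inner ℝ x ξ : ℝ)) ^ k / (k.factorial : ℂ) := by fun_prop
        exact this.aestronglyMeasurable
      · intro k
        refine Filter.Eventually.of_forall fun x => ?_
        simp
      · exact Filter.Eventually.of_forall fun x => (hs x).summable
      · have : (fun x => ∑' k : ℕ, |inner ℝ x ξ| ^ k / (k.factorial : ℝ) * ‖f x‖)
          = fun x => Real.exp |inner ℝ x ξ| * ‖f x‖ := funext fun x => (hs x).tsum_eq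
        rw [this]; exact hexpf ξ
      · refine Filter.Eventually.of_forall fun x => ?_
        have := NormedSpace.expSeries_div_hasSum_exp (Complex.I * (inner ℝ x ξ : ℝ) : ℂ)
        rw [← Complex.exp_eq_exp_ℂ] at this
        exact this.mul_right _
    have hz : ∀ k : ℕ, ∫ x, (Complex.I * (inner ℝ x ξ : ℝ)) ^ k / (k.factorial : ℂ) * f x = 0 := by
      intro k
      have e : ∀ x, (Complex.I * (inner ℝ x ξ : ℝ)) ^ k / (k.factorial : ℂ) * f x
        = (Complex.I ^ k / (k.factorial : ℂ)) * (((inner ℝ x ξ : ℝ) : ℂ) ^ k * f x) := by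
        intro x; rw [mul_pow]; ring
      simp only [e]
      rw [integral_const_mul, hmom, mul_zero]
    simp only [hz] at hsum
    exact hsum.unique hasSum_zero
  rw [Lp.eq_zero_iff_ae_eq_zero]
  filter_upwards [hzero] with x hx
  rcases mul_eq_zero.1 hx with h | h
  · exact absurd (star_eq_zero.1 h) (hg0 x)
  · exact h

end QRes


namespace QRes

open MeasureTheory SchwartzMap

theorem exists_ladder {n : ℕ} (Y : Fin n → (Fin n ⊕ Fin n) → ℂ)
    (hY0 : ∀ j k, sympForm (Y j) (Y k) = 0)
    (hY1 : ∀ j k, sympForm (star (Y j)) (Y k) = if j = k then Complex.I else 0)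
    (r : ℝ) (hr : 0 < r) :
    ∃ L : Ladder n (Sch n) (L2 n), L.ι = (conc n r hr.ne').ι ∧
      (∀ j, L.b j = (conc n r hr.ne').ell (star (Y j))) ∧
      (∀ j, L.bs j = (conc n r hr.ne').ell (Y j)) := by
  obtain ⟨G, hGs, hGY, c, hc, hGc⟩ := exists_gaussMat Y hY0 hY1
  have hc2 : 0 < c / (2 * r ^ 2) := by positivity
  obtain ⟨g, hg⟩ := exists_gauss (qexp G r) (qexp_tg G r) (c / (2 * r ^ 2)) hc2
    (qexp_re G r hr c hGc)
  have hg0 : ∀ x, g x ≠ 0 := fun x => by rw [hg]; exact Complex.exp_ne_zero _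
  have hgb : ∀ x, ‖g x‖ ≤ Real.exp (-(c / (2 * r ^ 2)) * ‖x‖ ^ 2) := fun x => by
    rw [hg, Complex.norm_exp]
    exact Real.exp_le_exp.2 (qexp_re G r hr c hGc x)
  set K := conc n r hr.ne' with hK
  have hιg : K.ι g ≠ 0 := by
    intro h0
    have h1 : (toLpCLM ℂ ℂ 2 volume g : L2 n) = 0 := h0
    rw [toLpCLM_apply] at h1
    have h2 : g = 0 := by
      apply SchwartzMap.injective_toLp (p := 2) (μ := (volume : Measure (EuclideanSpace ℝ (Fin n))))
      refine h1.trans ?_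
      exact (map_zero (toLpCLM ℂ ℂ 2 (volume : Measure (EuclideanSpace ℝ (Fin n))))).symm
    apply hg0 0
    rw [h2]; rfl
  have hN : ‖K.ι g‖ ≠ 0 := norm_ne_zero_iff.2 hιg
  have hNc : ((‖K.ι g‖ : ℝ) : ℂ) ≠ 0 := by exact_mod_cast hN
  refine ⟨
    { ι := K.ι
      b := fun j => K.ell (star (Y j))
      bs := fun j => K.ell (Y j)
      adj := fun j u v => K.ell_adj _ u v
      ccr := ?_
      comm := ?_
      g := ((‖K.ι g‖ : ℝ) : ℂ)⁻¹ • g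
      bg := ?_
      gnorm := ?_
      complete := ?_ }, rfl, fun j => rfl, fun j => rfl⟩
  · intro j k u
    rw [K.ell_comm, hY1]
    by_cases h : j = k <;> simp [h]
  · intro j k
    refine LinearMap.ext fun u => ?_
    change K.ell (Y j) (K.ell (Y k) u) = K.ell (Y k) (K.ell (Y j) u)
    rw [K.ell_comm, hY0]; simp
  · intro j
    rw [map_smul, gauss_kill G hGs r hr g hg _ (hGY j), smul_zero]
  · rw [map_smul, norm_smul, norm_inv, Complex.norm_real, norm_norm, inv_mul_cancel₀ hN]
  · intro E hgE hE v hv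
    have hgE' : g ∈ E := by
      have := E.smul_mem ((‖K.ι g‖ : ℝ) : ℂ) hgE
      rwa [smul_smul, mul_inv_cancel₀ hNc, one_smul] at this
    refine complete_gauss r hr g hg0 _ hc2 hgb E hgE' ?_ v hv
    intro j u hu
    have h1 : K.R (Sum.inl j) u ∈ E := by
      rw [K.R_eq Y hY0 hY1]
      refine E.sum_mem fun a _ => E.smul_mem _ ?_
      rcases a with a | a
      · exact (hE a u hu).1
      · exact (hE a u hu).2
    exact h1

theorem final {n : ℕ}
    (A B C : Matrix (Fin n) (Fin n) ℂ) (hAs : A.IsSymm) (hCs : C.IsSymm)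
    (hpos : ∀ x ξ : Fin n → ℝ, ¬(x = 0 ∧ ξ = 0) →
      0 < (qForm A B C (fun j => (x j : ℂ)) (fun j => (ξ j : ℂ))).re)
    (F : Matrix (Fin n ⊕ Fin n) (Fin n ⊕ Fin n) ℂ)
    (hF : ∀ X Y, sympForm X (F.mulVec Y) = qPolar A B C X Y)
    (lam : Fin n → ℂ) (hlam : ∀ j, 0 < (lam j).im)
    (hchar : F.charpoly =
      ∏ j, ((Polynomial.X - Polynomial.C (lam j)) * (Polynomial.X + Polynomial.C (lam j))))
    (Ω : Set ℂ) (hΩ : Bornology.IsBounded Ω) :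
    ∃ h₀ > 0, ∀ C' > 0, ∃ A' > 0, ∀ h : ℝ, 0 < h → h ≤ h₀ →
      ∀ z ∈ Ω, 1 / C' ≤ Metric.infDist z (specSet lam h) →
      ∀ u : SchwartzMap (EuclideanSpace ℝ (Fin n)) ℂ,
        l2Norm (fun x => u x) ≤ A' * Real.exp (A' / h) *
          l2Norm (fun x => weylQuant A B C h (fun y => u y) x - z * u x) := by
  obtain ⟨Y, T, hT0, hTl, hT, hY0, hY1⟩ := lin_main A B C hAs hCs hpos F hF lam hlam hchar
  obtain ⟨c₀, hc₀, hco⟩ := coercive A B C hAs hCs hpos (fun j => star (Y j))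
  obtain ⟨R, hR⟩ := hΩ.exists_norm_le
  refine ⟨1, one_pos, fun C' hC' => ?_⟩
  obtain ⟨A', hA', hest⟩ := Ladder.abstract_est n (-Complex.I * ∑ j, T j j)
    (fun j k => -2 * Complex.I * T j k) (fun j k => - qPolar A B C (star (Y j)) (star (Y k)))
    (fun j k hjk => by simp [hT0 j k hjk]) c₀ hc₀ (max R 0) (le_max_right _ _) (1 / C') (by positivity)
  refine ⟨A' + 1, by positivity, fun h hh hh1 z hz hd u => ?_⟩
  have hr : 0 < Real.sqrt h := Real.sqrt_pos.2 hh
  have hr2 : Real.sqrt h ^ 2 = h := Real.sq_sqrt hh.le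
  have hhc : (h : ℂ) ≠ 0 := by exact_mod_cast hh.ne'
  obtain ⟨L, hLi, hLb, hLbs⟩ := exists_ladder Y hY0 hY1 (Real.sqrt h) hr
  set K := conc n (Real.sqrt h) hr.ne' with hK
  have hQ : ∀ u, L.Qop (-Complex.I * ∑ j, T j j)
      (fun j k => -2 * Complex.I * T j k) (fun j k => - qPolar A B C (star (Y j)) (star (Y k))) u
      = K.Qq A B C u := by
    intro u
    rw [K.Qq_normal Y hY0 hY1 A B C hAs hCs F hF T hT, Ladder.Qop]
    simp only [hLb, hLbs]
  have key := hest h hh hh1 (Sch n) (L2 n) L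
    (fun u => by
      rw [hQ, hLi]
      simp only [hLb]
      exact hco (Sch n) (L2 n) K u)
    (z / h)
    (by
      rw [norm_div, Complex.norm_real, Real.norm_of_nonneg hh.le]
      gcongr
      exact (hR z hz).trans (le_max_left _ _))
    (by
      intro α
      have hmem : (h : ℂ) / Complex.I * ∑ j, lam j * (2 * (α j : ℂ) + 1) ∈ specSet lam h := ⟨α, rfl⟩
      have h1 := hd.trans (Metric.infDist_le_dist_of_mem hmem)
      rw [dist_comm, dist_eq_norm] at h1
      have h2 : (h : ℂ) / Complex.I * ∑ j, lam j * (2 * (α j : ℂ) + 1) - z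
          = (h : ℂ) * (-Complex.I * ∑ j, T j j + ∑ j, -2 * Complex.I * T j j * α j - z / h) := by
        have h3 : (h : ℂ) * (z / h) = z := by field_simp
        rw [mul_sub, h3, div_eq_mul_inv, Complex.inv_I]
        congr 1
        rw [mul_assoc]
        congr 1
        simp only [hTl, Finset.mul_sum]
        rw [← Finset.sum_add_distrib]
        refine Finset.sum_congr rfl fun j _ => ?_
        ring
      rw [h2, norm_mul, Complex.norm_real, Real.norm_of_nonneg hh.le] at h1
      rw [div_le_iff₀ hh, mul_comm]
      exact h1)
    u
  rw [hQ, hLi] at key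
  have e1 : ‖K.ι u‖ = l2Norm (fun x => u x) := norm_S u
  have e2 : l2Norm (fun x => weylQuant A B C h (fun y => u y) x - z * u x)
      = h * ‖K.ι (K.Qq A B C u - (z / h : ℂ) • u)‖ := by
    have e3 : (fun x => weylQuant A B C h (fun y => u y) x - z * u x)
        = fun x => ((h : ℂ) • (K.Qq A B C u - (z / h : ℂ) • u)) x := by
      funext x
      rw [weyl_eq A B C h _ hr hr2, SchwartzMap.smul_apply, SchwartzMap.sub_apply,
        SchwartzMap.smul_apply, smul_eq_mul, smul_eq_mul, mul_sub, ← mul_assoc (h : ℂ) (z / h)]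
      congr 2
      field_simp
    rw [e3, ← norm_S, map_smul, norm_smul, Complex.norm_real, Real.norm_of_nonneg hh.le]
    rfl
  rw [e1] at key
  rw [e2]
  refine key.trans ?_
  have hx : 1 / h ≤ Real.exp (1 / h) := by linarith [Real.add_one_le_exp (1 / h)]
  have h5 : (1:ℝ) ≤ Real.exp (1 / h) * h := by rwa [div_le_iff₀ hh] at hx
  have h6 : Real.exp ((A' + 1) / h) = Real.exp (A' / h) * Real.exp (1 / h) := by
    rw [← Real.exp_add]; congr 1; ring
  set N := ‖K.ι (K.Qq A B C u - (z / h : ℂ) • u)‖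
  have hN : 0 ≤ N := norm_nonneg _
  have hE : 0 ≤ Real.exp (A' / h) := (Real.exp_pos _).le
  rw [h6]
  calc A' * Real.exp (A' / h) * N ≤ (A' + 1) * Real.exp (A' / h) * N * 1 := by
        rw [mul_one]; gcongr; linarith
    _ ≤ (A' + 1) * Real.exp (A' / h) * N * (Real.exp (1 / h) * h) := by
        gcongr
    _ = _ := by ring

end QRes

/-- Let `q` be a complex quadratic form on ℝⁿ×ℝⁿ with `Re q` positive definite,
`F` its Hamilton map (defined by `σ(X,FY) = q(X,Y)`), and `λ₁,…,λ_n` the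
eigenvalues of `F` with positive imaginary part, repeated according to algebraic
multiplicity. Let `Ω ⊂ ℂ` be bounded. There is `h₀ > 0` such that for every
`C > 0` there is `A > 0` with: for all `h ∈ (0,h₀]`, all `z ∈ Ω` with
`dist(z,Λ_h) ≥ 1/C`, and all Schwartz `u`,
`‖u‖_{L²} ≤ A e^{A/h} ‖(q^w(x,hD_x) − z)u‖_{L²}`. -/
theorem statement_0 {n : ℕ} (hn : 1 ≤ n)
    (A B C : Matrix (Fin n) (Fin n) ℂ) (hAs : A.IsSymm) (hCs : C.IsSymm)
    (hpos : ∀ x ξ : Fin n → ℝ, ¬(x = 0 ∧ ξ = 0) →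
      0 < (qForm A B C (fun j => (x j : ℂ)) (fun j => (ξ j : ℂ))).re)
    (F : Matrix (Fin n ⊕ Fin n) (Fin n ⊕ Fin n) ℂ)
    (hF : ∀ X Y, sympForm X (F.mulVec Y) = qPolar A B C X Y)
    (lam : Fin n → ℂ) (hlam : ∀ j, 0 < (lam j).im)
    (hchar : F.charpoly =
      ∏ j, ((Polynomial.X - Polynomial.C (lam j)) * (Polynomial.X + Polynomial.C (lam j))))
    (Ω : Set ℂ) (hΩ : Bornology.IsBounded Ω) :
    ∃ h₀ > 0, ∀ C' > 0, ∃ A' > 0, ∀ h : ℝ, 0 < h → h ≤ h₀ →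
      ∀ z ∈ Ω, 1 / C' ≤ Metric.infDist z (specSet lam h) →
      ∀ u : SchwartzMap (EuclideanSpace ℝ (Fin n)) ℂ,
        l2Norm (fun x => u x) ≤ A' * Real.exp (A' / h) *
          l2Norm (fun x => weylQuant A B C h (fun y => u y) x - z * u x) := by
  exact QRes.final A B C hAs hCs hpos F hF lam hlam hchar Ω hΩ
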